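/- arXiv:1802.06188 — 10 statements merged into one kernel-verified Lean document; each statement's English description precedes it below -/
import Mathlib

section
/- For every n ≥ 1, the Fubini number satisfies F_n = n! · det H_n(R), where R(j) = (−1)^{j−1}/j!. -/
open Nat Finset

/-- Hessenberg-Toeplitz matrix `H_n(R)`: rows/columns indexed `1,…,n`;
entry `(i,j)` is `R(i-j+1)` if `i ≥ j`, `1` if `j = i+1`, `0` if `j > i+1`. -/
def hess (R : ℕ → ℚ) (n : ℕ) : Matrix (Fin n) (Fin n) ℚ :=
  Matrix.of fun i j =>
    if (j : ℕ) ≤ (i : ℕ) then R ((i : ℕ) - (j : ℕ) + 1)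
    else if (j : ℕ) = (i : ℕ) + 1 then 1 else 0

/-- Fubini numbers: the number of ordered set partitions of an `n`-element set
into nonempty blocks (ordered partitions into `k` blocks correspond to
surjections onto `Fin k`). -/
def fubini (n : ℕ) : ℕ :=
  ∑ k ∈ Finset.range (n + 1),
    (Finset.univ.filter fun f : Fin n → Fin k => Function.Surjective f).card

/-- A sequence annihilated by the rows of the infinite Hessenberg matrix computes the
determinants of its finite truncations. -/
theorem det_hess_of_recurrence (R e : ℕ → ℚ) (h0 : e 0 = 1)
    (h : ∀ i, ∑ j ∈ range (i + 1), R (i - j + 1) * e j + e (i + 1) = 0) (n : ℕ) :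
    (hess R n).det = (-1) ^ n * e n := by
  cases n with
  | zero => simp [h0]
  | succ n =>
    set M := hess R (n + 1) with hM
    have hMe : M.mulVec (fun j => e j) = Pi.single (Fin.last n) (-e (n + 1)) := by
      ext i
      have hrow : ∀ m, (i : ℕ) + 1 ≤ m → ∑ j ∈ range m,
          (if j ≤ (i : ℕ) then R (i - j + 1) else if j = (i : ℕ) + 1 then 1 else 0) * e j =
          ∑ j ∈ range (i + 1), R (i - j + 1) * e j +
            if (i : ℕ) + 1 < m then e (i + 1) else 0 := by
        intro m hm
        induction m, hm using Nat.le_induction with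
        | base =>
          simp only [lt_irrefl, if_false, add_zero]
          refine sum_congr rfl fun j hj => ?_
          rw [if_pos (by simpa [Nat.lt_succ_iff] using hj)]
        | succ m hm ih =>
          rw [sum_range_succ, ih, if_neg (by omega : ¬ m ≤ (i : ℕ)), add_assoc]
          congr 1
          rcases hm.eq_or_lt with rfl | hlt
          · simp
          · simp [hlt, hlt.ne', hlt.trans (Nat.lt_succ_self m)]
      have hsum := hrow (n + 1) i.isLt
      rw [← Fin.sum_univ_eq_sum_range (fun j =>
        (if j ≤ (i : ℕ) then R (i - j + 1) else if j = (i : ℕ) + 1 then 1 else 0) * e j)] at hsum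
      have hdef : M.mulVec (fun j => e j) i = _ := hsum
      rw [hdef]
      have hi := h i
      rcases eq_or_ne i (Fin.last n) with rfl | hne
      · simp only [Fin.val_last, lt_irrefl, if_false, Pi.single_eq_same] at hi ⊢
        linarith
      · have hlt : (i : ℕ) + 1 < n + 1 := by
          have := Fin.val_lt_last hne
          omega
        rw [if_pos hlt, hi, Pi.single_eq_of_ne hne]
    have hminor : (M.submatrix (Fin.last n).succAbove (0 : Fin (n + 1)).succAbove).det = 1 := by
      rw [Matrix.det_of_isLowerTriangular]
      · simp [hM, hess]
      · intro i j hij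
        have hij' : (i : ℕ) < j := hij
        simp only [hM, hess, Matrix.submatrix_apply, Matrix.of_apply, Fin.succAbove_last,
          Fin.succAbove_zero, Fin.val_castSucc, Fin.val_succ]
        rw [if_neg (by omega), if_neg (by omega)]
    have hadj := congrFun (congrArg M.adjugate.mulVec hMe) 0
    rw [Matrix.mulVec_mulVec, Matrix.adjugate_mul, Matrix.mulVec_single,
      Matrix.smul_mulVec, Matrix.one_mulVec] at hadj
    simp only [Pi.smul_apply, Fin.val_zero, h0, Matrix.col_apply,
      Matrix.adjugate_fin_succ_eq_det_submatrix, hminor, Fin.val_last, smul_eq_mul,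
      MulOpposite.smul_eq_mul_unop, MulOpposite.unop_op] at hadj
    rw [mul_one] at hadj
    rw [hadj]
    ring

/-- The number of surjections from an `n`-element set onto a `k`-element set. -/
def numSurj (n k : ℕ) : ℕ :=
  (univ.filter fun f : Fin n → Fin k => Function.Surjective f).card

theorem card_surjective_eq_numSurj {α : Type*} [Fintype α] [DecidableEq α] (k : ℕ) :
    Fintype.card {f : α → Fin k // Function.Surjective f} = numSurj (Fintype.card α) k := by
  rw [numSurj, ← Fintype.card_subtype]
  refine Fintype.card_congr
    ((Equiv.arrowCongr (Fintype.equivFin α) (Equiv.refl _)).subtypeEquiv fun f => ?_)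
  simp [Equiv.arrowCongr]

/-- Surjections onto `Fin (k + 1)` with prescribed complement `s` of the fibre over `0`
are surjections from `s` onto `Fin k`. -/
def surjectiveWithSupportEquiv {α : Type*} [Fintype α] [DecidableEq α] (k : ℕ) (s : Finset α)
    (hs : s ≠ univ) :
    {f : α → Fin (k + 1) // Function.Surjective f ∧ univ.filter (fun a => f a ≠ 0) = s} ≃
      {g : s → Fin k // Function.Surjective g} where
  toFun f := ⟨fun a => (f.1 a).pred (by
      exact (mem_filter.1 (f.2.2.ge a.2)).2), fun b => by
    obtain ⟨a, ha⟩ := f.2.1 b.succ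
    have has : a ∈ s := by
      rw [← f.2.2]
      simp [ha]
    exact ⟨⟨a, has⟩, by simp [ha]⟩⟩
  invFun g := ⟨fun a => if ha : a ∈ s then (g.1 ⟨a, ha⟩).succ else 0, by
    constructor
    · intro b
      refine Fin.cases ?_ (fun b => ?_) b
      · obtain ⟨a, ha⟩ : ∃ a, a ∉ s := by
          by_contra! hall
          exact hs (eq_univ_iff_forall.2 hall)
        exact ⟨a, dif_neg ha⟩
      · obtain ⟨a, ha⟩ := g.2 b
        exact ⟨a, by simp [ha]⟩
    · ext a
      by_cases ha : a ∈ s <;> simp [ha]⟩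
  left_inv f := by
    ext a
    by_cases ha : a ∈ s
    · simp [ha]
    · have hfa : f.1 a = 0 := by
        rw [← f.2.2] at ha
        simpa using ha
      simp [ha, hfa]
  right_inv g := by
    ext a
    simp

theorem numSurj_succ_right (n k : ℕ) :
    numSurj (n + 1) (k + 1) = ∑ m ∈ range (n + 1), (n + 1).choose m * numSurj m k := by
  have hcount : ∀ s : Finset (Fin (n + 1)),
      ((univ.filter fun f : Fin (n + 1) → Fin (k + 1) => Function.Surjective f).filter
        fun f => univ.filter (fun a => f a ≠ 0) = s).card =
      if s.card < n + 1 then numSurj s.card k else 0 := by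
    intro s
    by_cases hs : s = univ
    · subst hs
      simp only [Finset.card_univ, Fintype.card_fin, lt_irrefl, if_false, Finset.card_eq_zero]
      refine filter_eq_empty_iff.2 fun f hf hfu => ?_
      obtain ⟨a, ha⟩ := (mem_filter.1 hf).2 0
      have hau := mem_univ a
      rw [← hfu] at hau
      exact (mem_filter.1 hau).2 ha
    · have hlt : s.card < n + 1 := by
        simpa using (card_lt_iff_ne_univ s).2 hs
      rw [if_pos hlt, filter_filter, ← Fintype.card_subtype,
        Fintype.card_congr (surjectiveWithSupportEquiv k s hs), card_surjective_eq_numSurj,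
        Fintype.card_coe]
  rw [numSurj, card_eq_sum_card_fiberwise
    (f := fun f : Fin (n + 1) → Fin (k + 1) => univ.filter fun a => f a ≠ 0)
    (t := univ.powerset) (fun _ _ => by simp)]
  simp_rw [hcount]
  rw [sum_powerset_apply_card (fun m => if m < n + 1 then numSurj m k else 0),
    Finset.card_univ, Fintype.card_fin, sum_range_succ]
  simp only [lt_irrefl, if_false, smul_eq_mul, mul_zero, add_zero]
  refine sum_congr rfl fun m hm => ?_
  rw [if_pos (mem_range.1 hm)]

theorem numSurj_eq_zero_of_lt {n k : ℕ} (h : n < k) : numSurj n k = 0 := by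
  rw [numSurj, Finset.card_eq_zero]
  refine filter_eq_empty_iff.2 fun f _ hf => ?_
  have := Fintype.card_le_of_surjective f hf
  simp only [Fintype.card_fin] at this
  omega

theorem numSurj_succ_zero (n : ℕ) : numSurj (n + 1) 0 = 0 := by
  simp [numSurj]

theorem fubini_eq_sum_range {n N : ℕ} (h : n < N) : fubini n = ∑ k ∈ range N, numSurj n k := by
  refine sum_subset (range_mono h) fun k _ hk => numSurj_eq_zero_of_lt ?_
  simpa [Nat.succ_le_iff] using hk

theorem fubini_zero : fubini 0 = 1 := by
  simp [fubini, Function.Surjective]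

theorem fubini_succ (n : ℕ) :
    fubini (n + 1) = ∑ m ∈ range (n + 1), (n + 1).choose m * fubini m := by
  rw [fubini_eq_sum_range (Nat.lt_succ_self (n + 1)), sum_range_succ', numSurj_succ_zero, add_zero]
  simp_rw [numSurj_succ_right]
  rw [sum_comm]
  refine sum_congr rfl fun m hm => ?_
  rw [fubini_eq_sum_range (mem_range.1 hm), mul_sum]

theorem fubini_eq_det (n : ℕ) (hn : 1 ≤ n) :
    (fubini n : ℚ) =
      (n ! : ℚ) * (hess (fun j => (-1 : ℚ) ^ (j - 1) / (j ! : ℚ)) n).det := by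
  rw [det_hess_of_recurrence _ (fun j => (-1) ^ j * fubini j / j !)]
  · have hsign : ((-1 : ℚ) ^ n) * (-1) ^ n = 1 := by
      rw [← mul_pow]
      simp
    have hfact : (n ! : ℚ) ≠ 0 := by positivity
    field_simp
    linear_combination (-(fubini n : ℚ)) * hsign
  · simp [fubini_zero]
  · intro i
    rw [fubini_succ]
    push_cast
    rw [mul_sum, sum_div, ← sum_add_distrib]
    refine sum_eq_zero fun j hj => ?_
    have hji : j ≤ i := Nat.lt_succ_iff.1 (mem_range.1 hj)
    obtain ⟨d, rfl⟩ := Nat.exists_eq_add_of_le hji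
    rw [Nat.cast_choose ℚ (by omega : j ≤ j + d + 1), show j + d - j + 1 = d + 1 by omega,
      show j + d + 1 - j = d + 1 by omega, Nat.add_sub_cancel_left]
    have h1 : (j ! : ℚ) ≠ 0 := by positivity
    have h2 : ((d + 1)! : ℚ) ≠ 0 := by positivity
    have h3 : ((j + d + 1)! : ℚ) ≠ 0 := by positivity
    field_simp
    ring
end

section
/- Let (α_n)_{n≥0} be a sequence of rational numbers with α_0 = 1 and R : ℕ → ℚ a function such that α_n = det H_n(R) for all n ≥ 1. Then for every n ≥ 1, R(n) = det H_n(α'), where α' : ℕ → ℚ is the function α'(j) = α_j. -/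
open Nat Finset

/-- The matrix `hess R (n + 1)` with its first column replaced by `c`. -/
def hessWithColumn (R c : ℕ → ℚ) (n : ℕ) : Matrix (Fin (n + 1)) (Fin (n + 1)) ℚ :=
  Matrix.of fun i j => if j = 0 then c i else hess R (n + 1) i j

theorem hessWithColumn_self (R : ℕ → ℚ) (n : ℕ) :
    hessWithColumn R (fun k => R (k + 1)) n = hess R (n + 1) := by
  ext i j
  by_cases hj : j = 0 <;> simp [hessWithColumn, hess, hj]

theorem hessWithColumn_submatrix_succ (R c : ℕ → ℚ) (n : ℕ) :
    (hessWithColumn R c n).submatrix Fin.succ Fin.succ = hess R n := by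
  ext i j
  simp [hessWithColumn, hess]

theorem hessWithColumn_submatrix_succAbove_one (R c : ℕ → ℚ) (n : ℕ) :
    (hessWithColumn R c (n + 1)).submatrix Fin.succ (Fin.succ 0).succAbove =
      hessWithColumn R (fun k => c (k + 1)) n := by
  ext i j
  refine Fin.cases ?_ (fun j => ?_) j
  · simp [hessWithColumn]
  · simp [hessWithColumn, hess]

theorem det_hessWithColumn_succ (R c : ℕ → ℚ) (n : ℕ) :
    (hessWithColumn R c (n + 1)).det =
      c 0 * (hess R (n + 1)).det - (hessWithColumn R (fun k => c (k + 1)) n).det := by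
  rw [Matrix.det_succ_row_zero, Fin.sum_univ_succ, Fin.sum_univ_succ,
    Finset.sum_eq_zero, hessWithColumn_submatrix_succAbove_one, Fin.succAbove_zero,
    hessWithColumn_submatrix_succ]
  · simp [hessWithColumn, hess]
    ring
  · intro j _
    simp [hessWithColumn, hess]

theorem det_hessWithColumn (R c : ℕ → ℚ) (n : ℕ) :
    (hessWithColumn R c n).det =
      ∑ k ∈ range (n + 1), (-1) ^ k * c k * (hess R (n - k)).det := by
  induction n generalizing c with
  | zero => simp [hessWithColumn]
  | succ n ih =>
    rw [det_hessWithColumn_succ, ih, Finset.sum_range_succ' _ (n + 1), sub_eq_neg_add,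
      ← Finset.sum_neg_distrib]
    congr 1
    · refine Finset.sum_congr rfl fun k _ => ?_
      rw [Nat.add_sub_add_right, pow_succ]
      ring
    · simp

theorem det_hess_succ (R : ℕ → ℚ) (n : ℕ) :
    (hess R (n + 1)).det =
      ∑ k ∈ range (n + 1), (-1) ^ k * R (k + 1) * (hess R (n - k)).det := by
  rw [← hessWithColumn_self, det_hessWithColumn]

theorem inversion_formula (α : ℕ → ℚ) (hα : α 0 = 1) (R : ℕ → ℚ)
    (h : ∀ n : ℕ, 1 ≤ n → α n = (hess R n).det) :
    ∀ n : ℕ, 1 ≤ n → R n = (hess (fun j => α j) n).det := by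
  have hdet : ∀ n, (hess R n).det = α n := by
    rintro (_ | n)
    · simp [hα]
    · exact (h _ n.succ_pos).symm
  intro n
  induction n using Nat.strong_induction_on with
  | _ n ih =>
    intro hn
    obtain ⟨n, rfl⟩ := Nat.exists_eq_succ_of_ne_zero (Nat.one_le_iff_ne_zero.mp hn)
    have hrec := det_hess_succ R n
    simp only [hdet] at hrec
    rw [Finset.sum_range_succ, Nat.sub_self, hα, ← Finset.sum_range_reflect] at hrec
    rw [Nat.succ_eq_add_one, det_hess_succ, Finset.sum_range_succ, Nat.sub_self,
      Matrix.det_fin_zero, hrec, mul_one, mul_one, mul_add, Finset.mul_sum, ← mul_assoc,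
      ← mul_pow, neg_one_mul, neg_neg, one_pow, one_mul, ← add_assoc,
      ← Finset.sum_add_distrib, Finset.sum_eq_zero, zero_add]
    intro k hk
    have hkn := Finset.mem_range.mp hk
    rw [← ih (n - k) (by omega) (by omega)]
    obtain ⟨m, rfl⟩ := Nat.exists_eq_add_of_lt hkn
    have h₁ : k + m + 1 - 1 - k = m := by omega
    have h₂ : k + m + 1 - k = m + 1 := by omega
    have h₃ : k + m + 1 - m = k + 1 := by omega
    have hsq : ((-1 : ℚ) ^ m) * (-1) ^ m = 1 := by rw [← mul_pow]; norm_num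
    rw [h₁, h₂, h₃, pow_succ, pow_add]
    linear_combination (-(-1) ^ k * R (m + 1) * α (k + 1)) * hsq
end

section
/- For every n ≥ 1, F_n/n! = Σ ((t_1+⋯+t_n)!/(t_1!⋯t_n!)) · (−1)^{n−(t_1+⋯+t_n)} · Π_{j=1}^{n} ((−1)^{j−1}/j!)^{t_j}, where the sum ranges over all tuples (t_1,…,t_n) of nonnegative integers with t_1 + 2t_2 + ⋯ + n·t_n = n. -/
open Nat Finset

open PowerSeries in
theorem coeff_exp_pow (m n : ℕ) :
    coeff n (exp ℚ ^ m) = (m : ℚ) ^ n / n ! := by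
  rw [exp_pow_eq_rescale_exp, coeff_rescale, coeff_exp]
  simp [div_eq_mul_inv]

/-- Every function is a surjection onto its image. -/
theorem pow_eq_sum_choose_mul_card_surjective (m n : ℕ) :
    m ^ n = ∑ k ∈ range (m + 1), m.choose k *
      #{f : Fin n → Fin k | Function.Surjective f} := by
  have image_card (s : Finset (Fin m)) :
      #{f : Fin n → Fin m | univ.image f = s} =
        #{f : Fin n → Fin #s | Function.Surjective f} := by
    symm
    refine card_bij (fun f _ i => s.orderEmbOfFin rfl (f i)) ?_ ?_ ?_
    · intro f hf
      simp only [mem_filter, mem_univ, true_and] at hf ⊢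
      rw [← coe_inj, coe_image, coe_univ, Set.image_univ]
      change Set.range (s.orderEmbOfFin rfl ∘ f) = s
      rw [hf.range_comp, range_orderEmbOfFin]
    · intro f _ g _ h
      funext i
      exact (s.orderEmbOfFin rfl).injective (congrFun h i)
    · intro g hg
      simp only [mem_filter, mem_univ, true_and] at hg
      have mem (i : Fin n) : g i ∈ Set.range (s.orderEmbOfFin rfl) := by
        rw [range_orderEmbOfFin, ← hg]
        simp
      choose f hf using mem
      refine ⟨f, ?_, funext hf⟩
      simp only [mem_filter, mem_univ, true_and]
      intro b
      have hb : s.orderEmbOfFin rfl b ∈ univ.image g := by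
        rw [hg]
        exact orderEmbOfFin_mem s rfl b
      obtain ⟨i, -, hi⟩ := mem_image.1 hb
      exact ⟨i, (s.orderEmbOfFin rfl).injective ((hf i).trans hi)⟩
  calc
    m ^ n = #(univ : Finset (Fin n → Fin m)) := by simp
    _ = ∑ s ∈ (univ : Finset (Fin m)).powerset, #{f : Fin n → Fin m | univ.image f = s} :=
      card_eq_sum_card_fiberwise (by simp)
    _ = ∑ s ∈ (univ : Finset (Fin m)).powerset,
          #{f : Fin n → Fin #s | Function.Surjective f} := by simp only [image_card]
    _ = _ := by
      rw [sum_powerset_apply_card fun k => #{f : Fin n → Fin k | Function.Surjective f}]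
      simp

open PowerSeries in
theorem card_surjective_div_factorial (n k : ℕ) :
    (#{f : Fin n → Fin k | Function.Surjective f} : ℚ) / n ! =
      coeff n ((exp ℚ - 1) ^ k) := by
  induction k using Nat.strong_induction_on with
  | _ k ih =>
    have hcard : (k : ℚ) ^ n / n ! = ∑ j ∈ range (k + 1), (k.choose j : ℚ) *
        ((#{f : Fin n → Fin j | Function.Surjective f} : ℚ) / n !) := by
      have h := congrArg (fun x : ℕ => (x : ℚ) / n !) (pow_eq_sum_choose_mul_card_surjective k n)
      simpa [sum_div, mul_div_assoc] using h
    have hexp : (k : ℚ) ^ n / n ! = ∑ j ∈ range (k + 1), (k.choose j : ℚ) *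
        coeff n ((exp ℚ - 1) ^ j) := by
      rw [← coeff_exp_pow]
      conv_lhs => rw [← sub_add_cancel (exp ℚ) 1, add_pow]
      rw [map_sum]
      refine sum_congr rfl fun j _ => ?_
      rw [one_pow, mul_one, mul_comm, ← map_natCast (C (R := ℚ)), coeff_C_mul]
    rw [hcard, sum_range_succ, sum_range_succ,
      sum_congr rfl fun j hj => by rw [ih j (mem_range.1 hj)]] at hexp
    simpa using hexp

open PowerSeries in
theorem coeff_exp_sub_one_pow (n k : ℕ) :
    coeff n ((exp ℚ - 1) ^ k) =
      coeff n ((∑ j : Fin n, monomial (j + 1 : ℕ) (1 / ((j + 1 : ℕ)! : ℚ))) ^ k) := by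
  have hdvd : (X : ℚ⟦X⟧) ^ (n + 1) ∣
      (exp ℚ - 1) - ∑ j : Fin n, monomial (j + 1 : ℕ) (1 / ((j + 1 : ℕ)! : ℚ)) := by
    rw [X_pow_dvd_iff]
    intro m hm
    rw [Fin.sum_univ_eq_sum_range fun j => monomial (j + 1) (1 / ((j + 1)! : ℚ))]
    rcases m with _ | m
    · simp [coeff_monomial, -coeff_zero_eq_constantCoeff, coeff_exp]
    · simp [coeff_monomial, coeff_exp, coeff_one, show m < n by omega]
  have h := X_pow_dvd_iff.1 (hdvd.trans (sub_dvd_pow_sub_pow _ _ k)) n n.lt_succ_self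
  rwa [map_sub, sub_eq_zero] at h

open PowerSeries in
theorem coeff_sum_monomial_pow {ι R : Type*} [Fintype ι] [DecidableEq ι] [CommSemiring R]
    (d : ι → ℕ) (c : ι → R) (n k : ℕ) :
    coeff n ((∑ j, monomial (d j) (c j)) ^ k) =
      ∑ t ∈ piAntidiag univ k with ∑ j, d j * t j = n,
        (Nat.multinomial univ t : R) * ∏ j, c j ^ t j := by
  rw [sum_pow_eq_sum_piAntidiag, map_sum, sum_filter]
  refine sum_congr rfl fun t _ => ?_
  have hprod : ∏ j, monomial (d j) (c j) ^ t j =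
      monomial (∑ j, d j * t j) (∏ j, c j ^ t j) := by
    simp only [monomial_eq_C_mul_X_pow, mul_pow, prod_mul_distrib, ← pow_mul, prod_pow_eq_pow_sum,
      map_prod, map_pow]
  rw [hprod, ← map_natCast (C (R := R)), coeff_C_mul, coeff_monomial]
  simp [eq_comm]

theorem fubini_trudi (n : ℕ) (hn : 1 ≤ n) :
    (fubini n : ℚ) / (n ! : ℚ) =
      ∑ t ∈ (Fintype.piFinset fun _ : Fin n => Finset.range (n + 1)).filter
          (fun t => ∑ j : Fin n, ((j : ℕ) + 1) * t j = n),
        (Nat.multinomial Finset.univ t : ℚ) * (-1 : ℚ) ^ (n - ∑ j : Fin n, t j) *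
          ∏ j : Fin n, ((-1 : ℚ) ^ (j : ℕ) / (((j : ℕ) + 1)! : ℚ)) ^ t j := by
  have hsign (t : Fin n → ℕ) (ht : ∑ j : Fin n, ((j : ℕ) + 1) * t j = n) :
      (Nat.multinomial univ t : ℚ) * (-1 : ℚ) ^ (n - ∑ j : Fin n, t j) *
          ∏ j : Fin n, ((-1 : ℚ) ^ (j : ℕ) / (((j : ℕ) + 1)! : ℚ)) ^ t j =
        (Nat.multinomial univ t : ℚ) * ∏ j : Fin n, (1 / (((j : ℕ) + 1)! : ℚ)) ^ t j := by
    have hsub : n - ∑ j : Fin n, t j = ∑ j : Fin n, (j : ℕ) * t j := by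
      simp only [add_mul, one_mul, sum_add_distrib] at ht
      omega
    have hprod : ∏ j : Fin n, ((-1 : ℚ) ^ (j : ℕ) / (((j : ℕ) + 1)! : ℚ)) ^ t j =
        (-1) ^ (∑ j : Fin n, (j : ℕ) * t j) *
          ∏ j : Fin n, (1 / (((j : ℕ) + 1)! : ℚ)) ^ t j := by
      rw [← prod_pow_eq_pow_sum, ← prod_mul_distrib]
      refine prod_congr rfl fun j _ => ?_
      rw [pow_mul, ← mul_pow, mul_one_div]
    rw [hsub, hprod, mul_assoc, ← mul_assoc ((-1 : ℚ) ^ _), ← mul_pow]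
    simp
  have hle (t : Fin n → ℕ) (ht : ∑ j : Fin n, ((j : ℕ) + 1) * t j = n) :
      ∑ j, t j ≤ n := by
    simp only [add_mul, one_mul, sum_add_distrib] at ht
    omega
  rw [sum_congr rfl fun t ht => hsign t (mem_filter.1 ht).2,
    ← sum_fiberwise_of_maps_to (t := range (n + 1)) (g := fun t => ∑ j, t j)
      fun t ht => mem_range.2 (Nat.lt_succ_of_le (hle t (mem_filter.1 ht).2))]
  rw [fubini, Nat.cast_sum, sum_div]
  refine sum_congr rfl fun k _ => ?_
  rw [card_surjective_div_factorial, coeff_exp_sub_one_pow, coeff_sum_monomial_pow]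
  refine sum_congr ?_ fun _ _ => rfl
  ext t
  simp only [mem_filter, mem_piAntidiag, Fintype.mem_piFinset, mem_range, mem_univ, implies_true,
    and_true]
  refine ⟨fun ⟨hk, ht⟩ => ⟨⟨fun j => ?_, ht⟩, hk⟩, fun ⟨⟨_, ht⟩, hk⟩ => ⟨hk, ht⟩⟩
  exact Nat.lt_succ_of_le ((single_le_sum_of_canonicallyOrdered (mem_univ j)).trans (hle t ht))
end

section
/- For every n ≥ 1, det H_n(α) = (−1)^{n−1}/n!, where α : ℕ → ℚ is the function α(k) = F_k/k!. -/
open Nat Finset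

/-- The functions `Fin n → Fin k` whose range is `s` correspond to surjections onto `Fin #s`. -/
theorem card_filter_image_eq (n k : ℕ) (s : Finset (Fin k)) :
    #{f : Fin n → Fin k | univ.image f = s} =
      #{f : Fin n → Fin #s | Function.Surjective f} := by
  symm
  refine card_bij (fun f _ i => (s.equivFin.symm (f i) : Fin k)) ?_ ?_ ?_
  · intro f hf
    simp only [mem_filter, mem_univ, true_and] at hf ⊢
    ext x
    simp only [mem_image, mem_univ, true_and]
    constructor
    · rintro ⟨i, rfl⟩
      exact (s.equivFin.symm (f i)).2
    · intro hx
      obtain ⟨i, hi⟩ := hf (s.equivFin ⟨x, hx⟩)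
      exact ⟨i, by simp [hi]⟩
  · intro f _ g _ h
    funext i
    exact s.equivFin.symm.injective (Subtype.ext (congrFun h i))
  · intro g hg
    simp only [mem_filter, mem_univ, true_and] at hg
    have hmem (i : Fin n) : g i ∈ s := hg ▸ mem_image_of_mem g (mem_univ i)
    refine ⟨fun i => s.equivFin ⟨g i, hmem i⟩, ?_, by simp⟩
    simp only [mem_filter, mem_univ, true_and]
    intro y
    have hy : (s.equivFin.symm y : Fin k) ∈ univ.image g := hg ▸ (s.equivFin.symm y).2
    obtain ⟨i, -, hi⟩ := mem_image.1 hy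
    exact ⟨i, by simp [hi]⟩

theorem sum_choose_mul_card_surjective (n k : ℕ) :
    ∑ j ∈ range (k + 1), k.choose j * #{f : Fin n → Fin j | Function.Surjective f} = k ^ n := by
  have h := sum_powerset_apply_card
    (fun j => #{f : Fin n → Fin j | Function.Surjective f}) (x := (univ : Finset (Fin k)))
  simp only [Finset.card_univ, Fintype.card_fin, smul_eq_mul] at h
  rw [← h]
  simp_rw [← card_filter_image_eq]
  rw [← card_eq_sum_card_fiberwise (fun f _ => by simp)]
  simp

open PowerSeries in
/-- The exponential generating function of the numbers of surjections onto `Fin k`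
is `(exp - 1) ^ k`. -/
theorem mk_card_surjective_div_factorial (k : ℕ) :
    (PowerSeries.mk fun n => (#{f : Fin n → Fin k | Function.Surjective f} : ℚ) / (n ! : ℚ)) =
      (exp ℚ - 1) ^ k := by
  induction k using Nat.strong_induction_on with
  | _ k ih =>
    have hexp : ∑ j ∈ range (k + 1), (k.choose j : ℚ⟦X⟧) * (exp ℚ - 1) ^ j = exp ℚ ^ k := by
      conv_rhs => rw [← sub_add_cancel (exp ℚ) 1, add_pow]
      exact sum_congr rfl fun j _ => by ring
    have hsurj : ∑ j ∈ range (k + 1), (k.choose j : ℚ⟦X⟧) *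
        (PowerSeries.mk fun n => (#{f : Fin n → Fin j | Function.Surjective f} : ℚ) / (n ! : ℚ)) =
        exp ℚ ^ k := by
      ext n
      rw [exp_pow_eq_rescale_exp, coeff_rescale, coeff_exp, map_sum]
      have h := congrArg (Nat.cast : ℕ → ℚ) (sum_choose_mul_card_surjective n k)
      push_cast at h
      rw [← h, sum_mul]
      refine sum_congr rfl fun j _ => ?_
      rw [← map_natCast (C (R := ℚ)), coeff_C_mul, coeff_mk]
      simp [div_eq_mul_inv, mul_assoc]
    rw [sum_range_succ, Nat.choose_self, Nat.cast_one, one_mul] at hexp hsurj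
    rw [sum_congr rfl fun j hj => by rw [ih j (mem_range.1 hj)]] at hsurj
    exact add_left_cancel (hsurj.trans hexp.symm)

open PowerSeries in
theorem mk_fubini_div_factorial_mul :
    (PowerSeries.mk fun n => (fubini n : ℚ) / (n ! : ℚ)) * (2 - exp ℚ) = 1 := by
  have hX : (X : ℚ⟦X⟧) ∣ exp ℚ - 1 := by
    rw [X_dvd_iff]
    simp
  have hcoeff (m n : ℕ) (hmn : m ≤ n) :
      coeff m (PowerSeries.mk fun n => (fubini n : ℚ) / (n ! : ℚ)) =
        coeff m (∑ k ∈ range (n + 1), (exp ℚ - 1) ^ k) := by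
    have hvanish : ∀ k ∈ range (n + 1), k ∉ range (m + 1) → coeff m ((exp ℚ - 1) ^ k) = 0 := by
      intro k _ hk
      exact X_pow_dvd_iff.1 (pow_dvd_pow_of_dvd hX k) m (by simpa using hk)
    rw [map_sum, ← sum_subset (range_mono (by lia)) hvanish, coeff_mk, fubini, Nat.cast_sum,
      sum_div]
    exact sum_congr rfl fun k _ => by rw [← mk_card_surjective_div_factorial, coeff_mk]
  ext n
  have hgeom : (∑ k ∈ range (n + 1), (exp ℚ - 1) ^ k) * (2 - exp ℚ) =
      1 - (exp ℚ - 1) ^ (n + 1) := by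
    rw [← geom_sum_mul_neg]
    ring
  calc
    _ = coeff n ((∑ k ∈ range (n + 1), (exp ℚ - 1) ^ k) * (2 - exp ℚ)) := by
      rw [coeff_mul, coeff_mul]
      exact sum_congr rfl fun p hp => by rw [hcoeff p.1 n (by have := mem_antidiagonal.1 hp; lia)]
    _ = coeff n (1 : ℚ⟦X⟧) := by
      rw [hgeom, map_sub,
        X_pow_dvd_iff.1 (pow_dvd_pow_of_dvd hX (n + 1)) n n.lt_succ_self, sub_zero]

open PowerSeries Matrix in
/-- Hessenberg-Toeplitz determinants of the coefficients of a power series `f` with constant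
coefficient `1` are, up to sign, the coefficients of its inverse. -/
theorem det_hess_coeff (f g : ℚ⟦X⟧) (hf : coeff 0 f = 1) (hfg : f * g = 1) (n : ℕ) :
    (hess (fun k => coeff k f) n).det = (-1) ^ n * coeff n g := by
  let A : Matrix (Fin (n + 1)) (Fin (n + 1)) ℚ :=
    Matrix.of fun i j => if (j : ℕ) ≤ i then coeff ((i : ℕ) - j) f else 0
  let v : Fin (n + 1) → ℚ := fun k => coeff (k : ℕ) g
  have hdet : A.det = 1 := by
    rw [det_of_isLowerTriangular A fun i j hij => if_neg (not_le.2 hij)]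
    simp [A, hf]
  have hAv : A *ᵥ v = Pi.single 0 1 := by
    ext i
    have hi := congrArg (coeff (i : ℕ)) hfg
    rw [mul_comm, coeff_mul, Nat.sum_antidiagonal_eq_sum_range_succ_mk, coeff_one] at hi
    calc
      (A *ᵥ v) i = ∑ k ∈ range (n + 1),
          if k ≤ (i : ℕ) then coeff k g * coeff ((i : ℕ) - k) f else 0 := by
        rw [← Fin.sum_univ_eq_sum_range
          (fun k => if k ≤ (i : ℕ) then coeff k g * coeff ((i : ℕ) - k) f else 0)]
        simp [A, v, mulVec, dotProduct, mul_comm]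
      _ = ∑ k ∈ range ((i : ℕ) + 1), coeff k g * coeff ((i : ℕ) - k) f := by
        rw [← sum_filter]
        refine sum_congr ?_ fun _ _ => rfl
        ext k
        simp only [mem_filter, mem_range]
        lia
      _ = (Pi.single 0 1 : Fin (n + 1) → ℚ) i := by
        rw [hi, Pi.single_apply]
        exact if_congr (by rw [Fin.ext_iff, Fin.val_zero]) rfl rfl
  have hv : v = A.adjugate *ᵥ Pi.single 0 1 := by
    rw [← hAv, mulVec_mulVec, adjugate_mul, hdet, one_smul, one_mulVec]
  have hminor : A.submatrix (Fin.succAbove 0) (Fin.succAbove (Fin.last n)) =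
      hess (fun k => coeff k f) n := by
    ext i j
    simp only [A, hess, submatrix_apply, of_apply, Fin.succAbove_zero, Fin.succAbove_last,
      Fin.val_succ, Fin.val_castSucc]
    split_ifs with h₁ h₂ h₃ h₄ h₅
    · rw [Nat.sub_add_comm h₂]
    · rw [h₃, Nat.sub_self, hf]
    all_goals first | rfl | lia
  have hlast := congrFun hv (Fin.last n)
  rw [mulVec_single_one, col_apply, adjugate_fin_succ_eq_det_submatrix, hminor] at hlast
  simp only [v, Fin.val_last, Fin.val_zero, zero_add] at hlast
  rw [hlast, ← mul_assoc, ← mul_pow]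
  simp

theorem det_fubini_ratios (n : ℕ) (hn : 1 ≤ n) :
    (hess (fun k => (fubini k : ℚ) / (k ! : ℚ)) n).det = (-1 : ℚ) ^ (n - 1) / (n ! : ℚ) := by
  have hf : PowerSeries.coeff 0 (PowerSeries.mk fun k => (fubini k : ℚ) / (k ! : ℚ)) = 1 := by
    simp [fubini, Function.Surjective]
  have h := det_hess_coeff _ _ hf mk_fubini_div_factorial_mul n
  simp only [PowerSeries.coeff_mk] at h
  obtain ⟨m, rfl⟩ := Nat.exists_eq_add_of_le' hn
  have htwo : PowerSeries.coeff (m + 1) (2 : PowerSeries ℚ) = 0 := by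
    rw [← map_ofNat (PowerSeries.C (R := ℚ)), PowerSeries.coeff_C, if_neg m.succ_ne_zero]
  rw [h, map_sub, htwo, PowerSeries.coeff_exp, Nat.add_sub_cancel, pow_succ]
  simp [div_eq_mul_inv]
end

section
/- For every m ≥ 1 and n ≥ 1, F_{n,≤m}/n! = Σ ((t_1+⋯+t_m)!/(t_1!⋯t_m!)) · (−1)^{n−(t_1+⋯+t_m)} · Π_{j=1}^{m} ((−1)^{j−1}/j!)^{t_j}, where the sum ranges over all tuples (t_1,…,t_m) of nonnegative integers with t_1 + 2t_2 + ⋯ + m·t_m = n. -/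
open Nat Finset

/-- Restricted Fubini numbers `F_{n,≤m}`: ordered set partitions of an
`n`-element set into nonempty blocks each of size at most `m`. -/
def fubiniRes (m n : ℕ) : ℕ :=
  ∑ k ∈ Finset.range (n + 1),
    (Finset.univ.filter fun f : Fin n → Fin k =>
      Function.Surjective f ∧
        ∀ i : Fin k, (Finset.univ.filter fun x => f x = i).card ≤ m).card

/-- The number of functions `Fin n → Fin k` with prescribed fiber sizes is a multinomial
coefficient. -/
theorem card_filter_fiber_card_eq_multinomial {k n : ℕ} (c : Fin k → ℕ) (hc : ∑ b, c b = n) :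
    #{f : Fin n → Fin k | ∀ b, #{x | f x = b} = c b} = Nat.multinomial univ c := by
  have key := (Fintype.sum_pow (MvPolynomial.X : Fin k → MvPolynomial (Fin k) ℕ) n).symm.trans
    (Finset.sum_pow_eq_sum_piAntidiag univ _ n)
  have prod_X (f : Fin n → Fin k) : ∏ i, (MvPolynomial.X (f i) : MvPolynomial (Fin k) ℕ) =
      MvPolynomial.monomial (Finsupp.equivFunOnFinite.symm fun b => #{x | f x = b}) 1 := by
    rw [← Finset.prod_fiberwise univ f, MvPolynomial.monomial_eq,
      Finsupp.prod_fintype _ _ (by simp)]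
    simp only [map_one, one_mul]
    refine Finset.prod_congr rfl fun b _ => ?_
    rw [Finset.prod_congr rfl (g := fun _ => MvPolynomial.X b) (by simp +contextual)]
    simp
  have prod_X_pow (e : Fin k → ℕ) : ∏ b, (MvPolynomial.X b : MvPolynomial (Fin k) ℕ) ^ e b =
      MvPolynomial.monomial (Finsupp.equivFunOnFinite.symm e) 1 := by
    rw [MvPolynomial.monomial_eq, Finsupp.prod_fintype _ _ (by simp)]
    simp
  simp only [prod_X, prod_X_pow] at key
  have coeff_natCast_mul (d : Fin k →₀ ℕ) (a : ℕ) (p : MvPolynomial (Fin k) ℕ) :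
      MvPolynomial.coeff d ((a : MvPolynomial (Fin k) ℕ) * p) = a * MvPolynomial.coeff d p := by
    rw [← nsmul_eq_mul, MvPolynomial.coeff_smul, smul_eq_mul]
  have hcoeff := congrArg (MvPolynomial.coeff (Finsupp.equivFunOnFinite.symm c)) key
  simp only [MvPolynomial.coeff_sum, coeff_natCast_mul, MvPolynomial.coeff_monomial,
    EmbeddingLike.apply_eq_iff_eq,
    mul_ite, mul_one, mul_zero, sum_ite_eq'] at hcoeff
  simpa [hc, funext_iff] using hcoeff

/-- The fibers of `f` have sizes in `[1, m]`: classify `f` by the predecessors of its fiber sizes. -/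
theorem card_surjective_fiber_le (m n k : ℕ) :
    #{f : Fin n → Fin k | Function.Surjective f ∧ ∀ i, #{x | f x = i} ≤ m} =
      ∑ g : Fin k → Fin m with ∑ i, ((g i : ℕ) + 1) = n,
        Nat.multinomial univ fun i => (g i : ℕ) + 1 := by
  have hset : ({f : Fin n → Fin k | Function.Surjective f ∧ ∀ i, #{x | f x = i} ≤ m} :
      Finset (Fin n → Fin k)) =
      ({g : Fin k → Fin m | ∑ i, ((g i : ℕ) + 1) = n} : Finset _).biUnion
        fun g => {f : Fin n → Fin k | ∀ i, #{x | f x = i} = (g i : ℕ) + 1} := by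
    ext f
    simp only [mem_filter, mem_univ, true_and, mem_biUnion]
    constructor
    · rintro ⟨hsurj, hle⟩
      have hpos (i : Fin k) : 0 < #{x | f x = i} := by
        obtain ⟨x, hx⟩ := hsurj i
        exact card_pos.2 ⟨x, by simp [hx]⟩
      refine ⟨fun i => ⟨#{x | f x = i} - 1, by have := hpos i; have := hle i; omega⟩, ?_, ?_⟩
      · simp only [Nat.sub_add_cancel (hpos _)]
        simpa using (card_eq_sum_card_fiberwise (f := f) (s := univ) (t := univ) (by simp)).symm
      · exact fun i => (Nat.sub_add_cancel (hpos i)).symm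
    · rintro ⟨g, -, hg⟩
      refine ⟨fun i => ?_, fun i => by rw [hg i]; exact (g i).isLt⟩
      obtain ⟨x, hx⟩ := card_pos.1 ((hg i).symm ▸ Nat.succ_pos _ : 0 < #{x | f x = i})
      exact ⟨x, by simpa using hx⟩
  rw [hset, card_biUnion]
  · refine sum_congr rfl fun g hg => card_filter_fiber_card_eq_multinomial _ (mem_filter.1 hg).2
  · intro g _ g' _ hne
    refine Finset.disjoint_left.2 fun f hf hf' => hne (funext fun i => Fin.ext ?_)
    have h := (mem_filter.1 hf).2 i
    have h' := (mem_filter.1 hf').2 i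
    omega

theorem multinomial_div_factorial {ι : Type*} (s : Finset ι) (c : ι → ℕ) :
    (Nat.multinomial s c : ℚ) / ((∑ i ∈ s, c i)! : ℚ) = ∏ i ∈ s, (1 / ((c i)! : ℚ)) := by
  rw [← Nat.multinomial_spec s c, prod_div_distrib]
  have := Nat.multinomial_pos s c
  have : (∏ i ∈ s, ((c i)! : ℚ)) ≠ 0 := prod_ne_zero_iff.2 fun i _ => by positivity
  push_cast
  field_simp
  simp

/-- Grouping functions `Fin k → Fin m` of total weight `n` by their fiber sizes. -/
theorem sum_prod_eq_sum_multinomial (m n k : ℕ) (hk : k ≤ n) (w : Fin m → ℚ) :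
    ∑ g : Fin k → Fin m with ∑ i, ((g i : ℕ) + 1) = n, ∏ i, w (g i) =
      ∑ t ∈ (Fintype.piFinset fun _ : Fin m => range (n + 1)) with
          ∑ j : Fin m, ((j : ℕ) + 1) * t j = n ∧ ∑ j, t j = k,
        (Nat.multinomial univ t : ℚ) * ∏ j, w j ^ t j := by
  have weight (g : Fin k → Fin m) :
      ∑ j : Fin m, ((j : ℕ) + 1) * #{i | g i = j} = ∑ i, ((g i : ℕ) + 1) := by
    rw [← Finset.sum_fiberwise univ g]
    refine sum_congr rfl fun j _ => ?_
    rw [Finset.sum_congr rfl (g := fun _ => (j : ℕ) + 1) (by simp +contextual)]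
    simp [mul_comm]
  rw [← Finset.sum_fiberwise_of_maps_to (g := fun g j => #{i | g i = j})
    (t := {t ∈ Fintype.piFinset fun _ : Fin m => range (n + 1) |
      ∑ j : Fin m, ((j : ℕ) + 1) * t j = n ∧ ∑ j, t j = k})]
  · refine sum_congr rfl fun t ht => ?_
    obtain ⟨-, hn, hsum⟩ := mem_filter.1 ht
    rw [← card_filter_fiber_card_eq_multinomial t hsum, ← nsmul_eq_mul, ← sum_const, filter_filter]
    refine sum_congr ?_ fun g hg => ?_
    · ext g
      simp only [mem_filter, mem_univ, true_and, funext_iff]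
      refine ⟨fun h => h.2, fun h => ⟨?_, h⟩⟩
      rw [← weight]
      simpa only [h] using hn
    · rw [← Finset.prod_fiberwise univ g]
      refine prod_congr rfl fun j _ => ?_
      rw [Finset.prod_congr rfl (g := fun _ => w j) (by simp +contextual), prod_const,
        (mem_filter.1 hg).2 j]
  · intro g hg
    simp only [mem_filter, Fintype.mem_piFinset, mem_range]
    refine ⟨fun j => ?_, (weight g).trans (mem_filter.1 hg).2, ?_⟩
    · have := card_le_univ ({i | g i = j} : Finset (Fin k))
      simp only [Fintype.card_fin] at this
      omega
    · simpa using (card_eq_sum_card_fiberwise (f := g) (s := univ) (t := univ) (by simp)).symm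

theorem neg_one_pow_mul_prod_neg_one_pow_div {m n : ℕ} (t : Fin m → ℕ) (a : Fin m → ℚ)
    (ht : ∑ j : Fin m, ((j : ℕ) + 1) * t j = n) :
    (-1 : ℚ) ^ (n - ∑ j, t j) * ∏ j : Fin m, ((-1 : ℚ) ^ (j : ℕ) / a j) ^ t j =
      ∏ j, (1 / a j) ^ t j := by
  have hsub : n - ∑ j, t j = ∑ j : Fin m, (j : ℕ) * t j := by
    simp only [← ht, add_mul, one_mul, sum_add_distrib, Nat.add_sub_cancel]
  rw [hsub, ← prod_pow_eq_pow_sum, ← prod_mul_distrib]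
  refine prod_congr rfl fun j _ => ?_
  rw [pow_mul, ← mul_pow, ← mul_div_assoc, ← mul_pow]
  simp

theorem fubiniRes_trudi (m : ℕ) (hm : 1 ≤ m) (n : ℕ) (hn : 1 ≤ n) :
    (fubiniRes m n : ℚ) / (n ! : ℚ) =
      ∑ t ∈ (Fintype.piFinset fun _ : Fin m => Finset.range (n + 1)).filter
          (fun t => ∑ j : Fin m, ((j : ℕ) + 1) * t j = n),
        (Nat.multinomial Finset.univ t : ℚ) * (-1 : ℚ) ^ (n - ∑ j : Fin m, t j) *
          ∏ j : Fin m, ((-1 : ℚ) ^ (j : ℕ) / (((j : ℕ) + 1)! : ℚ)) ^ t j := by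
  have hmaps : ∀ t ∈ (Fintype.piFinset fun _ : Fin m => Finset.range (n + 1)).filter
      (fun t => ∑ j : Fin m, ((j : ℕ) + 1) * t j = n), ∑ j, t j ∈ range (n + 1) := by
    intro t ht
    rw [mem_range, Nat.lt_succ_iff, ← (mem_filter.1 ht).2]
    exact sum_le_sum fun j _ => Nat.le_mul_of_pos_left _ (Nat.succ_pos _)
  rw [← sum_fiberwise_of_maps_to hmaps, fubiniRes, Nat.cast_sum, sum_div]
  refine sum_congr rfl fun k hk => ?_
  rw [card_surjective_fiber_le, Nat.cast_sum, sum_div, filter_filter]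
  calc
    _ = ∑ g : Fin k → Fin m with ∑ i, ((g i : ℕ) + 1) = n,
          ∏ i, (1 / (((g i : ℕ) + 1)! : ℚ)) :=
      sum_congr rfl fun g hg => by
        rw [← multinomial_div_factorial, (mem_filter.1 hg).2]
    _ = _ := sum_prod_eq_sum_multinomial m n k (Nat.lt_succ_iff.1 (mem_range.1 hk))
          fun j => 1 / (((j : ℕ) + 1)! : ℚ)
    _ = _ := sum_congr rfl fun t ht => by
        rw [mul_assoc, neg_one_pow_mul_prod_neg_one_pow_div t _ (mem_filter.1 ht).2.1]
end

section
/- For every m ≥ 1 and every n > m, det H_n(α) = 0, where α : ℕ → ℚ is the function α(k) = F_{k,≤m}/k!. -/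
open Nat Finset

/-- The truncated exponential `∑_{1 ≤ j ≤ m} X ^ j / j!`. -/
noncomputable def truncExp (m : ℕ) : PowerSeries ℚ :=
  PowerSeries.mk fun j => if j ∈ Icc 1 m then ((j ! : ℕ) : ℚ)⁻¹ else 0

lemma X_dvd_truncExp (m : ℕ) : PowerSeries.X ∣ truncExp m := by
  rw [PowerSeries.X_dvd_iff, ← PowerSeries.coeff_zero_eq_constantCoeff_apply]
  simp [truncExp]

lemma coeff_truncExp_pow_of_lt (m : ℕ) {i k : ℕ} (h : i < k) :
    PowerSeries.coeff i (truncExp m ^ k) = 0 :=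
  PowerSeries.X_pow_dvd_iff.1 (pow_dvd_pow_of_dvd (X_dvd_truncExp m) k) i h

lemma card_filter_fiber_zero_eq {α : Type} [Fintype α] [DecidableEq α] (m k : ℕ) (S : Finset α) :
    (univ.filter fun f : α → Fin (k + 1) =>
        (∀ i, (univ.filter fun x => f x = i).card ∈ Icc 1 m) ∧
          (univ.filter fun x => f x = 0) = S).card =
      if S.card ∈ Icc 1 m then
        (univ.filter fun g : {x // x ∉ S} → Fin k =>
          ∀ i, (univ.filter fun x => g x = i).card ∈ Icc 1 m).card
      else 0 := by
  split_ifs with hS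
  · symm
    have fiber_succ (g : {x // x ∉ S} → Fin k) (i : Fin k) :
        (univ.filter fun x => (if h : x ∈ S then 0 else (g ⟨x, h⟩).succ) = i.succ) =
          (univ.filter fun x => g x = i).map (Function.Embedding.subtype _) := by
      ext x
      by_cases hx : x ∈ S <;> simp [hx, (Fin.succ_ne_zero _).symm]
    have fiber_zero (g : {x // x ∉ S} → Fin k) :
        (univ.filter fun x => (if h : x ∈ S then 0 else (g ⟨x, h⟩).succ) = 0) = S := by
      ext x
      by_cases hx : x ∈ S <;> simp [hx]
    refine card_bij (fun g _ x => if h : x ∈ S then 0 else (g ⟨x, h⟩).succ) ?_ ?_ ?_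
    · intro g hg
      simp only [mem_filter, mem_univ, true_and] at hg ⊢
      refine ⟨fun i => ?_, fiber_zero g⟩
      cases i using Fin.cases with
      | zero => rwa [fiber_zero]
      | succ i => rw [fiber_succ, card_map]; exact hg i
    · intro g _ g' _ h
      ext1 x
      have := congrFun h x.1
      simpa [x.2] using this
    · intro f hf
      simp only [mem_filter, mem_univ, true_and] at hf
      obtain ⟨hf, hfS⟩ := hf
      have hne (x : α) : x ∉ S ↔ f x ≠ 0 := by simp [← hfS]
      have hext (x : α) : (if h : x ∈ S then 0 else
          ((f x).pred ((hne x).1 h)).succ) = f x := by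
        by_cases hx : x ∈ S
        · simpa [hx, eq_comm] using not_not.1 (mt (hne x).2 (not_not.2 hx))
        · simp [hx]
      refine ⟨fun x => (f x).pred ((hne x).1 x.2), ?_, funext hext⟩
      simp only [mem_filter, mem_univ, true_and]
      intro i
      rw [← card_map (Function.Embedding.subtype _), ← fiber_succ]
      simpa only [hext] using hf i.succ
  · rw [Finset.card_eq_zero, filter_eq_empty_iff]
    rintro f - ⟨hf, rfl⟩
    exact hS (hf 0)

lemma card_fiber_card_mem_Icc (m k : ℕ) (α : Type) [Fintype α] [DecidableEq α] :
    ((univ.filter fun f : α → Fin k =>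
        ∀ i, (univ.filter fun x => f x = i).card ∈ Icc 1 m).card : ℚ) =
      ((Fintype.card α)! : ℕ) * PowerSeries.coeff (Fintype.card α) (truncExp m ^ k) := by
  induction k generalizing α with
  | zero =>
    rcases isEmpty_or_nonempty α with h | h
    · simp
    · simp [PowerSeries.coeff_one]
  | succ k ih =>
    rw [card_eq_sum_card_fiberwise (f := fun f : α → Fin (k + 1) => univ.filter fun x => f x = 0)
      (t := univ.powerset) (fun _ _ => by simp)]
    simp only [filter_filter, card_filter_fiber_zero_eq]
    push_cast [ih]
    simp only [Fintype.card_subtype_compl, Fintype.card_coe]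
    rw [sum_powerset_apply_card (fun j => if j ∈ Icc 1 m then
      (((Fintype.card α - j)! : ℕ) : ℚ) *
        PowerSeries.coeff (Fintype.card α - j) (truncExp m ^ k) else 0), _root_.pow_succ',
      PowerSeries.coeff_mul, Finset.Nat.sum_antidiagonal_eq_sum_range_succ
        (fun i j => PowerSeries.coeff i (truncExp m) * PowerSeries.coeff j (truncExp m ^ k)),
      mul_sum, Finset.card_univ]
    refine sum_congr rfl fun j hj => ?_
    have hj : j ≤ Fintype.card α := Nat.lt_succ_iff.1 (mem_range.1 hj)
    simp only [truncExp, PowerSeries.coeff_mk]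
    split_ifs
    · rw [nsmul_eq_mul, Nat.cast_choose ℚ hj]
      field_simp
    · simp

lemma fubiniRes_div_factorial (m : ℕ) {i N : ℕ} (h : i ≤ N) :
    (fubiniRes m i : ℚ) / (i ! : ℚ) =
      PowerSeries.coeff i (∑ k ∈ range (N + 1), truncExp m ^ k) := by
  have surj_iff (k : ℕ) (f : Fin i → Fin k) : (Function.Surjective f ∧
      ∀ j, (univ.filter fun x => f x = j).card ≤ m) ↔
      ∀ j, (univ.filter fun x => f x = j).card ∈ Icc 1 m := by
    simp [Function.Surjective, forall_and, Nat.one_le_iff_ne_zero, filter_eq_empty_iff]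
  rw [map_sum, ← sum_subset (range_subset_range.2 (Nat.succ_le_succ h))
    (fun k _ hk => coeff_truncExp_pow_of_lt m (by simpa using hk))]
  simp only [fubiniRes, surj_iff]
  push_cast [card_fiber_card_mem_Icc]
  rw [← mul_sum, Fintype.card_fin]
  field_simp

lemma sum_fubiniRes_mul_coeff_one_sub_truncExp (m : ℕ) {N : ℕ} (hN : N ≠ 0) :
    ∑ j ∈ range (N + 1), (fubiniRes m (N - j) : ℚ) / ((N - j)! : ℚ) *
      PowerSeries.coeff j (1 - truncExp m) = 0 := by
  have h := congrArg (PowerSeries.coeff N) (mul_neg_geom_sum (truncExp m) (N + 1))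
  rw [PowerSeries.coeff_mul, Finset.Nat.sum_antidiagonal_eq_sum_range_succ
    (fun i j => PowerSeries.coeff i (1 - truncExp m) *
      PowerSeries.coeff j (∑ k ∈ range (N + 1), truncExp m ^ k)), map_sub,
    coeff_truncExp_pow_of_lt m N.lt_succ_self, PowerSeries.coeff_one, if_neg hN, sub_zero] at h
  rw [← h]
  refine sum_congr rfl fun j _ => ?_
  rw [fubiniRes_div_factorial m (N.sub_le j), mul_comm]

lemma fubiniRes_zero (m : ℕ) : fubiniRes m 0 = 1 := by
  have h := fubiniRes_div_factorial m (le_refl 0)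
  simpa using h

theorem det_fubiniRes_ratios (m : ℕ) (hm : 1 ≤ m) (n : ℕ) (hn : m < n) :
    (hess (fun k => (fubiniRes m k : ℚ) / (k ! : ℚ)) n).det = 0 := by
  rw [← Matrix.exists_mulVec_eq_zero_iff]
  refine ⟨fun j => PowerSeries.coeff (j : ℕ) (1 - truncExp m), fun h => ?_, ?_⟩
  · simpa [truncExp] using congrFun h ⟨0, by omega⟩
  · ext i
    have hi := i.2
    rw [Pi.zero_apply, ← sum_fubiniRes_mul_coeff_one_sub_truncExp m (Nat.succ_ne_zero i)]
    set c : ℕ → ℚ := fun j => PowerSeries.coeff j (1 - truncExp m) with hc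
    have hcn : c n = 0 := by
      have : n ≠ 0 := by omega
      simp [hc, truncExp, PowerSeries.coeff_one, this, hn]
    let e : ℕ → ℚ := fun j => (if j ≤ (i : ℕ) then
      (fubiniRes m (i - j + 1) : ℚ) / (((i : ℕ) - j + 1)! : ℚ)
      else if j = (i : ℕ) + 1 then 1 else 0) * c j
    calc _ = ∑ j ∈ range n, e j := (Fin.sum_univ_eq_sum_range e n)
      _ = ∑ j ∈ range (n + 1), e j := by rw [sum_range_succ]; simp [e, hcn]
      _ = ∑ j ∈ range ((i : ℕ) + 1 + 1), e j := by
        refine (sum_subset (range_subset_range.2 (by omega)) fun j _ hj => ?_).symm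
        rw [mem_range] at hj
        simp only [e]
        rw [if_neg (by omega), if_neg (by omega), zero_mul]
      _ = _ := by
        refine sum_congr rfl fun j hj => ?_
        rw [mem_range] at hj
        simp only [e]
        split_ifs with h1 h2
        · rw [Nat.succ_eq_add_one, Nat.sub_add_comm h1]
        · simp [h2, fubiniRes_zero, hc]
        · omega
end

section
/- For every m ≥ 1, as formal power series over ℚ one has (1 − Σ_{j≥m} X^j/j!) · (Σ_{n≥0} F_{n,≥m} X^n/n!) = 1; that is, the exponential generating function of the associated Fubini numbers is Σ_{n≥0} F_{n,≥m} X^n/n! = 1/(1 − X^m/m! − X^{m+1}/(m+1)! − ⋯). -/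
open Nat Finset

/-- Associated Fubini numbers `F_{n,≥m}`: ordered set partitions of an
`n`-element set into nonempty blocks each of size at least `m`. -/
def fubiniAss (m n : ℕ) : ℕ :=
  ∑ k ∈ Finset.range (n + 1),
    (Finset.univ.filter fun f : Fin n → Fin k =>
      Function.Surjective f ∧
        ∀ i : Fin k, m ≤ (Finset.univ.filter fun x => f x = i).card).card

/-- The exponential generating function `∑ w j X^j / j!` of a sequence `w`. -/
def expGenFun (w : ℕ → ℚ) : PowerSeries ℚ :=
  PowerSeries.mk fun j => w j / (j ! : ℚ)

lemma constantCoeff_expGenFun (w : ℕ → ℚ) : PowerSeries.constantCoeff (expGenFun w) = w 0 := by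
  rw [← PowerSeries.coeff_zero_eq_constantCoeff_apply, expGenFun, PowerSeries.coeff_mk]
  simp

lemma derivative_expGenFun (w : ℕ → ℚ) :
    PowerSeries.derivative ℚ (expGenFun w) = expGenFun fun j => w (j + 1) := by
  ext n
  have h1 : ((n : ℚ) + 1) ≠ 0 := by positivity
  have h2 : (n ! : ℚ) ≠ 0 := by positivity
  rw [PowerSeries.coeff_derivative]
  simp only [expGenFun, PowerSeries.coeff_mk, Nat.factorial_succ]
  push_cast
  field_simp

lemma card_filter_cons_eq {n : ℕ} {ι : Type*} [DecidableEq ι] (a i : ι) (g : Fin n → ι) :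
    (univ.filter fun x => (Fin.cons a g : Fin (n + 1) → ι) x = i).card =
      (univ.filter fun x => g x = i).card + if i = a then 1 else 0 := by
  simp only [Finset.card_filter, Fin.sum_univ_succ, Fin.cons_zero, Fin.cons_succ]
  rw [add_comm]
  simp only [eq_comm]

/-- Leibniz rule for the derivative of a finite product of power series. -/
lemma derivative_prod_powerSeries {R ι : Type*} [CommRing R] [DecidableEq ι] (s : Finset ι)
    (f : ι → PowerSeries R) :
    PowerSeries.derivative R (∏ i ∈ s, f i) =
      ∑ a ∈ s, (∏ i ∈ s.erase a, f i) * PowerSeries.derivative R (f a) := by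
  induction s using Finset.induction_on with
  | empty => simp
  | insert b s hb ih =>
    rw [Finset.prod_insert hb, Derivation.leibniz, ih, Finset.sum_insert hb,
      Finset.erase_insert hb, smul_eq_mul, smul_eq_mul, add_comm, Finset.mul_sum]
    congr 1
    refine Finset.sum_congr rfl fun a ha => ?_
    have hab : b ≠ a := fun h => hb (h ▸ ha)
    rw [Finset.erase_insert_of_ne hab, Finset.prod_insert fun h => hb (mem_of_mem_erase h),
      mul_assoc]

/-- Product formula for exponential generating functions: functions `Fin n → ι`, weighted
according to the sizes of their fibers, are counted by the product of the generating functions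
of the weights. -/
lemma sum_prod_card_fiber {ι : Type*} [Fintype ι] [DecidableEq ι] (n : ℕ) (w : ι → ℕ → ℚ) :
    ∑ f : Fin n → ι, ∏ i, w i (univ.filter fun x => f x = i).card =
      (n ! : ℚ) * PowerSeries.coeff n (∏ i, expGenFun (w i)) := by
  induction n generalizing w with
  | zero =>
    simp [PowerSeries.coeff_zero_eq_constantCoeff_apply, map_prod, constantCoeff_expGenFun]
  | succ n ih =>
    have key : ∀ a : ι, ∑ g : Fin n → ι,
        ∏ i, w i (univ.filter fun x => (Fin.cons a g : Fin (n + 1) → ι) x = i).card =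
        (n ! : ℚ) * PowerSeries.coeff n
          ((∏ i ∈ univ.erase a, expGenFun (w i)) *
            PowerSeries.derivative ℚ (expGenFun (w a))) := by
      intro a
      have h := ih fun i j => w i (j + if i = a then 1 else 0)
      simp only [card_filter_cons_eq]
      rw [h, ← Finset.prod_erase_mul univ _ (mem_univ a), derivative_expGenFun]
      congr 3
      · refine Finset.prod_congr rfl fun i hi => ?_
        simp [Finset.ne_of_mem_erase hi]
      · simp
    rw [← (Fin.consEquiv fun _ => ι).sum_comp, Fintype.sum_prod_type]
    simp only [Fin.consEquiv_apply]
    rw [Finset.sum_congr rfl fun a _ => key a, ← Finset.mul_sum, ← map_sum]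
    rw [← derivative_prod_powerSeries, PowerSeries.coeff_derivative, Nat.factorial_succ]
    push_cast
    ring

/-- If `A` has zero constant coefficient, then the series `∑ A^k`, cut off coefficientwise,
inverts `1 - A`. -/
lemma one_sub_mul_mk_sum_coeff_pow {R : Type*} [CommRing R] (A : PowerSeries R)
    (hA : PowerSeries.constantCoeff A = 0) :
    (1 - A) * PowerSeries.mk (fun n => ∑ k ∈ range (n + 1), PowerSeries.coeff n (A ^ k)) = 1 := by
  have hlt : ∀ n k, n < k → PowerSeries.coeff n (A ^ k) = 0 := fun n k h =>
    PowerSeries.X_pow_dvd_iff.1 (pow_dvd_pow_of_dvd (PowerSeries.X_dvd_iff.2 hA) k) n h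
  ext n
  have h : PowerSeries.coeff n ((1 - A) *
      PowerSeries.mk (fun n => ∑ k ∈ range (n + 1), PowerSeries.coeff n (A ^ k))) =
      PowerSeries.coeff n ((1 - A) * ∑ k ∈ range (n + 1), A ^ k) := by
    rw [PowerSeries.coeff_mul, PowerSeries.coeff_mul]
    refine Finset.sum_congr rfl fun p hp => ?_
    have hpn : p.2 ≤ n := by have := mem_antidiagonal.1 hp; omega
    rw [PowerSeries.coeff_mk, map_sum]
    congr 1
    refine Finset.sum_subset (range_mono (by omega)) fun k _ hk => hlt _ _ ?_
    simp only [Finset.mem_range] at hk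
    omega
  rw [h, mul_neg_geom_sum, map_sub, hlt n (n + 1) (Nat.lt_succ_self n), sub_zero]

lemma fubiniAss_eq_sum_coeff (m : ℕ) (hm : 1 ≤ m) (n : ℕ) :
    (fubiniAss m n : ℚ) = (n ! : ℚ) * ∑ k ∈ range (n + 1),
      PowerSeries.coeff n (expGenFun (fun j => if m ≤ j then 1 else 0) ^ k) := by
  rw [fubiniAss, Nat.cast_sum, Finset.mul_sum]
  refine Finset.sum_congr rfl fun k _ => ?_
  have h := sum_prod_card_fiber (ι := Fin k) n fun _ j => if m ≤ j then 1 else 0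
  rw [Finset.prod_const, Finset.card_univ, Fintype.card_fin] at h
  rw [← h, Finset.card_filter, Nat.cast_sum]
  refine Finset.sum_congr rfl fun f _ => ?_
  have hsurj : (∀ i, m ≤ (univ.filter fun x => f x = i).card) → Function.Surjective f := by
    intro hf i
    obtain ⟨x, hx⟩ := Finset.card_pos.1 (hm.trans (hf i))
    exact ⟨x, (Finset.mem_filter.1 hx).2⟩
  rw [Finset.prod_ite_zero]
  simp only [and_iff_right_of_imp hsurj, Finset.mem_univ, true_imp_iff, Finset.prod_const_one]
  split_ifs <;> simp

theorem fubiniAss_egf (m : ℕ) (hm : 1 ≤ m) :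
    (1 - PowerSeries.mk (fun j => if m ≤ j then 1 / (j ! : ℚ) else 0)) *
      PowerSeries.mk (fun n => (fubiniAss m n : ℚ) / (n ! : ℚ)) = 1 := by
  have hA : PowerSeries.mk (fun j => if m ≤ j then 1 / (j ! : ℚ) else 0) =
      expGenFun fun j => if m ≤ j then 1 else 0 := by
    ext j
    simp only [expGenFun, PowerSeries.coeff_mk]
    split_ifs <;> simp
  have h0 : PowerSeries.constantCoeff (expGenFun fun j => if m ≤ j then 1 else 0) = 0 := by
    rw [constantCoeff_expGenFun, if_neg (by omega)]
  rw [hA]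
  refine Eq.trans ?_ (one_sub_mul_mk_sum_coeff_pow _ h0)
  congr 1
  ext n
  rw [PowerSeries.coeff_mk, PowerSeries.coeff_mk, fubiniAss_eq_sum_coeff m hm,
    mul_div_cancel_left₀ _ (by positivity)]
end

section
/- For every m ≥ 1 and every n ≥ 1, the associated Fubini numbers satisfy the recurrence F_{n,≥m} = Σ_{j=m}^{n} C(n,j) · F_{n−j,≥m}, where C(n,j) is the binomial coefficient and the sum is empty when n < m. -/
open Nat Finset

/-- The maps `α → Fin k` all of whose fibers have at least `m` elements. -/
def largeFiberMaps (m : ℕ) (α : Type) [Fintype α] [DecidableEq α] (k : ℕ) :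
    Finset (α → Fin k) :=
  Finset.univ.filter fun f => ∀ i : Fin k, m ≤ (Finset.univ.filter fun x => f x = i).card

theorem mem_largeFiberMaps {m : ℕ} {α : Type} [Fintype α] [DecidableEq α] {k : ℕ}
    {f : α → Fin k} :
    f ∈ largeFiberMaps m α k ↔
      ∀ i : Fin k, m ≤ (Finset.univ.filter fun x => f x = i).card := by
  simp [largeFiberMaps]

theorem surjective_of_mem_largeFiberMaps {m : ℕ} (hm : 1 ≤ m) {α : Type} [Fintype α]
    [DecidableEq α] {k : ℕ} {f : α → Fin k} (hf : f ∈ largeFiberMaps m α k) :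
    Function.Surjective f := by
  intro i
  have h := hm.trans (mem_largeFiberMaps.1 hf i)
  obtain ⟨x, hx⟩ := Finset.card_pos.1 h
  exact ⟨x, (Finset.mem_filter.1 hx).2⟩

theorem card_largeFiberMaps_congr (m : ℕ) {α β : Type} [Fintype α] [DecidableEq α]
    [Fintype β] [DecidableEq β] (e : α ≃ β) (k : ℕ) :
    (largeFiberMaps m α k).card = (largeFiberMaps m β k).card := by
  refine Finset.card_equiv (e.arrowCongr (Equiv.refl (Fin k))) fun f => ?_
  rw [mem_largeFiberMaps, mem_largeFiberMaps]
  refine forall_congr' fun i => ?_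
  have h : (Finset.univ.filter fun x => f x = i).card =
      (Finset.univ.filter fun y => e.arrowCongr (Equiv.refl (Fin k)) f y = i).card :=
    Finset.card_equiv e fun x => by simp
  rw [h]

theorem card_largeFiberMaps_eq_zero {m : ℕ} (hm : 1 ≤ m) {α : Type} [Fintype α]
    [DecidableEq α] {k : ℕ} (hk : Fintype.card α < k) : (largeFiberMaps m α k).card = 0 := by
  rw [Finset.card_eq_zero, Finset.eq_empty_iff_forall_notMem]
  intro f hf
  have h := Fintype.card_le_of_surjective f (surjective_of_mem_largeFiberMaps hm hf)
  rw [Fintype.card_fin] at h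
  omega

theorem card_largeFiberMaps_fiber_zero {m : ℕ} {α : Type} [Fintype α] [DecidableEq α] {k : ℕ}
    (S : Finset α) (hS : m ≤ S.card) :
    ((largeFiberMaps m α (k + 1)).filter fun f =>
      (Finset.univ.filter fun x => f x = 0) = S).card =
      (largeFiberMaps m {x // x ∉ S} k).card := by
  symm
  let extend : ({x // x ∉ S} → Fin k) → α → Fin (k + 1) :=
    fun g x => if h : x ∈ S then 0 else (g ⟨x, h⟩).succ
  have extend_zero (g) : (Finset.univ.filter fun x => extend g x = 0) = S := by
    ext x
    by_cases h : x ∈ S <;> simp [extend, h, Fin.succ_ne_zero]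
  have extend_succ (g) (i : Fin k) : (Finset.univ.filter fun x => g x = i).card =
      (Finset.univ.filter fun x => extend g x = i.succ).card := by
    refine Finset.card_bij (fun x _ => x.1) ?_ (fun _ _ _ _ h => Subtype.ext h) ?_
    · rintro ⟨x, hx⟩ h
      simpa [extend, hx] using h
    · intro x hx
      by_cases h : x ∈ S
      · simp [extend, h, (Fin.succ_ne_zero _).symm] at hx
      · exact ⟨⟨x, h⟩, by simpa [extend, h] using hx, rfl⟩
  refine Finset.card_bij (fun g _ => extend g) ?_ ?_ ?_
  · intro g hg
    rw [Finset.mem_filter, mem_largeFiberMaps]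
    refine ⟨fun i => ?_, extend_zero g⟩
    induction i using Fin.cases with
    | zero => rwa [extend_zero]
    | succ i => exact (mem_largeFiberMaps.1 hg i).trans (extend_succ g i).le
  · intro g _ g' _ h
    funext x
    have hx := congrFun h x.1
    simpa [extend, x.2] using hx
  · intro f hf
    rw [Finset.mem_filter, mem_largeFiberMaps] at hf
    obtain ⟨hf, h0⟩ := hf
    have hne (x : {x // x ∉ S}) : f x.1 ≠ 0 := by
      intro h
      have hx : x.1 ∈ Finset.univ.filter fun y => f y = 0 := by simpa using h
      exact x.2 (h0 ▸ hx)
    have h_extend : extend (fun x => (f x.1).pred (hne x)) = f := by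
      funext x
      by_cases h : x ∈ S
      · have hx : f x = 0 := by simpa [← h0] using h
        simp [extend, h, hx]
      · simp [extend, h]
    refine ⟨fun x => (f x.1).pred (hne x), ?_, h_extend⟩
    rw [mem_largeFiberMaps]
    intro i
    rw [extend_succ, h_extend]
    exact hf i.succ

theorem card_largeFiberMaps_succ (m n k : ℕ) :
    (largeFiberMaps m (Fin n) (k + 1)).card =
      ∑ j ∈ Finset.Icc m n, n.choose j * (largeFiberMaps m (Fin (n - j)) k).card := by
  rw [Finset.card_eq_sum_card_fiberwise (t := (Finset.univ : Finset (Fin n)).powerset)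
    (f := fun f : Fin n → Fin (k + 1) => Finset.univ.filter fun x => f x = 0)
    (fun _ _ => by simp)]
  have key (S : Finset (Fin n)) :
      ((largeFiberMaps m (Fin n) (k + 1)).filter fun f =>
        (Finset.univ.filter fun x => f x = 0) = S).card =
      if m ≤ S.card then (largeFiberMaps m (Fin (n - S.card)) k).card else 0 := by
    split_ifs with hS
    · rw [card_largeFiberMaps_fiber_zero S hS]
      refine card_largeFiberMaps_congr m (Fintype.equivFinOfCardEq ?_) k
      simp [Fintype.card_subtype_compl]
    · rw [Finset.card_eq_zero, Finset.filter_eq_empty_iff]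
      rintro f hf rfl
      exact hS (mem_largeFiberMaps.1 hf 0)
  rw [Finset.sum_congr rfl fun S _ => key S, Finset.sum_powerset_apply_card
    (fun j => if m ≤ j then (largeFiberMaps m (Fin (n - j)) k).card else 0)]
  simp only [Finset.card_univ, Fintype.card_fin, smul_eq_mul, mul_ite, mul_zero]
  rw [← Finset.sum_filter]
  refine Finset.sum_congr ?_ fun _ _ => rfl
  ext j
  simp only [Finset.mem_filter, Finset.mem_range, Finset.mem_Icc]
  omega

theorem fubiniAss_eq_sum_card_largeFiberMaps {m : ℕ} (hm : 1 ≤ m) {n N : ℕ} (hN : n < N) :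
    fubiniAss m n = ∑ k ∈ Finset.range N, (largeFiberMaps m (Fin n) k).card := by
  have h : fubiniAss m n = ∑ k ∈ Finset.range (n + 1), (largeFiberMaps m (Fin n) k).card := by
    refine Finset.sum_congr rfl fun k _ => congrArg Finset.card ?_
    ext f
    simp only [Finset.mem_filter, Finset.mem_univ, true_and, ← mem_largeFiberMaps]
    exact and_iff_right_of_imp (surjective_of_mem_largeFiberMaps hm)
  rw [h]
  refine Finset.sum_subset (Finset.range_mono hN) fun k _ hk => ?_
  refine card_largeFiberMaps_eq_zero hm ?_
  simp only [Finset.mem_range, Fintype.card_fin] at hk ⊢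
  omega

theorem fubiniAss_recurrence (m : ℕ) (hm : 1 ≤ m) (n : ℕ) (hn : 1 ≤ n) :
    fubiniAss m n = ∑ j ∈ Finset.Icc m n, n.choose j * fubiniAss m (n - j) := by
  have : Nonempty (Fin n) := ⟨⟨0, hn⟩⟩
  have h0 : (largeFiberMaps m (Fin n) 0).card = 0 := by
    rw [Finset.card_eq_zero]
    exact Finset.eq_empty_of_isEmpty _
  rw [fubiniAss_eq_sum_card_largeFiberMaps hm n.lt_succ_self, Finset.sum_range_succ', h0,
    add_zero, Finset.sum_congr rfl fun k _ => card_largeFiberMaps_succ m n k, Finset.sum_comm]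
  refine Finset.sum_congr rfl fun j hj => ?_
  rw [← Finset.mul_sum, fubiniAss_eq_sum_card_largeFiberMaps hm (N := n)]
  rw [Finset.mem_Icc] at hj
  omega
end

section
/- For all integers n ≥ m ≥ 1, the associated Fubini number satisfies F_{n,≥m} = n! · det H_n(R), where R(j) = 0 for 1 ≤ j ≤ m−1 and R(j) = (−1)^{j−1}/j! for j ≥ m. -/
open Nat Finset

/-- The number of maps `α → Fin k` all of whose fibres have at least `m` elements. -/
def fiberBoundedCount (α : Type*) [Fintype α] [DecidableEq α] (m k : ℕ) : ℕ :=
  #{f : α → Fin k | ∀ i, m ≤ #{x | f x = i}}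

theorem fiberBoundedCount_congr {α β : Type*} [Fintype α] [DecidableEq α] [Fintype β]
    [DecidableEq β] (e : α ≃ β) (m k : ℕ) :
    fiberBoundedCount α m k = fiberBoundedCount β m k := by
  refine Finset.card_equiv (e.arrowCongr (Equiv.refl _)) fun f => ?_
  simp only [mem_filter, mem_univ, true_and]
  refine forall_congr' fun i => ?_
  rw [Finset.card_equiv (t := {x | (e.arrowCongr (Equiv.refl _)) f x = i}) e (by simp)]

/-- Extend a map off `S` to all of `α`, using a new value `0` on `S`. -/
def extendZero {α : Type*} [DecidableEq α] {k : ℕ} (S : Finset α)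
    (g : {x // x ∉ S} → Fin k) (x : α) : Fin (k + 1) :=
  if h : x ∈ S then 0 else (g ⟨x, h⟩).succ

theorem extendZero_injective {α : Type*} [DecidableEq α] {k : ℕ} (S : Finset α) :
    Function.Injective (extendZero (k := k) S) := by
  intro g g' h
  ext ⟨x, hx⟩
  simpa [extendZero, hx, Fin.ext_iff] using congrFun h x

section extendZero

variable {α : Type*} [Fintype α] [DecidableEq α] {k : ℕ} (S : Finset α)

theorem filter_extendZero_eq_zero (g : {x // x ∉ S} → Fin k) :
    ({x | extendZero S g x = 0} : Finset α) = S := by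
  ext x
  by_cases h : x ∈ S <;> simp [extendZero, h]

theorem card_filter_extendZero_eq_succ (g : {x // x ∉ S} → Fin k) (i : Fin k) :
    #{x | extendZero S g x = i.succ} = #{y | g y = i} := by
  rw [← Finset.card_map (Function.Embedding.subtype _)]
  congr 1
  ext x
  by_cases h : x ∈ S <;> simp [extendZero, h, Fin.ext_iff]

theorem exists_extendZero_eq (f : α → Fin (k + 1)) (hf : ({x | f x = 0} : Finset α) = S) :
    ∃ g, extendZero S g = f := by
  subst hf
  refine ⟨fun x => (f x).pred (by simpa using x.2), ?_⟩
  ext x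
  by_cases h : f x = 0 <;> simp [extendZero, h]

theorem card_filter_zero_fiber_eq (m : ℕ) :
    #{f : α → Fin (k + 1) | (∀ i, m ≤ #{x | f x = i}) ∧ ({x | f x = 0} : Finset α) = S} =
      if m ≤ #S then fiberBoundedCount {x // x ∉ S} m k else 0 := by
  split_ifs with hS
  · symm
    refine Finset.card_bij (fun g _ => extendZero S g) ?_
      (fun g _ g' _ h => extendZero_injective S h) ?_
    · intro g hg
      simp only [mem_filter, mem_univ, true_and] at hg ⊢
      refine ⟨Fin.cases ?_ fun i => ?_, filter_extendZero_eq_zero S g⟩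
      · rwa [filter_extendZero_eq_zero]
      · rw [card_filter_extendZero_eq_succ]
        exact hg i
    · intro f hf
      simp only [mem_filter, mem_univ, true_and] at hf
      obtain ⟨g, rfl⟩ := exists_extendZero_eq S f hf.2
      refine ⟨g, ?_, rfl⟩
      simp only [mem_filter, mem_univ, true_and]
      intro i
      rw [← card_filter_extendZero_eq_succ]
      exact hf.1 i.succ
  · rw [Finset.card_eq_zero, Finset.filter_eq_empty_iff]
    rintro f - ⟨h, rfl⟩
    exact hS (h 0)

end extendZero

theorem fiberBoundedCount_fin_succ (m n k : ℕ) :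
    fiberBoundedCount (Fin n) m (k + 1) =
      ∑ j ∈ range (n + 1), n.choose j *
        if m ≤ j then fiberBoundedCount (Fin (n - j)) m k else 0 := by
  have h := Finset.sum_powerset_apply_card
    (f := fun j => if m ≤ j then fiberBoundedCount (Fin (n - j)) m k else 0)
    (x := (univ : Finset (Fin n)))
  simp only [Finset.card_fin, smul_eq_mul] at h
  rw [← h, fiberBoundedCount, Finset.card_eq_sum_card_fiberwise
    (f := fun f : Fin n → Fin (k + 1) => ({x | f x = 0} : Finset (Fin n)))
    (t := univ.powerset) (by intro f _; simp)]
  refine Finset.sum_congr rfl fun S _ => ?_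
  rw [Finset.filter_filter, card_filter_zero_fiber_eq]
  congr 1
  refine fiberBoundedCount_congr (Fintype.equivFinOfCardEq ?_) m k
  simp

theorem surjective_of_forall_le_card_fiber {α : Type*} [Fintype α] {m k : ℕ} (hm : 1 ≤ m)
    {f : α → Fin k} (h : ∀ i, m ≤ #{x | f x = i}) : Function.Surjective f := by
  intro i
  obtain ⟨x, hx⟩ := Finset.card_pos.mp (hm.trans (h i))
  exact ⟨x, by simpa using hx⟩

theorem fiberBoundedCount_fin_eq_zero {m n k : ℕ} (hm : 1 ≤ m) (h : n < k) :
    fiberBoundedCount (Fin n) m k = 0 := by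
  rw [fiberBoundedCount, Finset.card_eq_zero, Finset.filter_eq_empty_iff]
  intro f _ hf
  have := Fintype.card_le_of_surjective f (surjective_of_forall_le_card_fiber hm hf)
  simp only [Fintype.card_fin] at this
  omega

theorem fubiniAss_eq_sum_fiberBoundedCount {m n N : ℕ} (hm : 1 ≤ m) (h : n ≤ N) :
    fubiniAss m n = ∑ k ∈ range (N + 1), fiberBoundedCount (Fin n) m k := by
  rw [← Finset.sum_subset (Finset.range_mono (Nat.succ_le_succ h))
    fun k _ hk => fiberBoundedCount_fin_eq_zero hm (by simpa using hk)]
  refine Finset.sum_congr rfl fun k _ => congrArg card (Finset.filter_congr fun f _ => ?_)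
  exact and_iff_right_of_imp (surjective_of_forall_le_card_fiber hm)

theorem fubiniAss_zero (m : ℕ) : fubiniAss m 0 = 1 := by
  simp [fubiniAss, Function.Surjective]

theorem fubiniAss_succ {m : ℕ} (hm : 1 ≤ m) (n : ℕ) :
    fubiniAss m (n + 1) =
      ∑ j ∈ range (n + 1), (n + 1).choose (j + 1) *
        if m ≤ j + 1 then fubiniAss m (n - j) else 0 := by
  have h0 : fiberBoundedCount (Fin (n + 1)) m 0 = 0 := by simp [fiberBoundedCount]
  have hm0 : ¬ m ≤ 0 := by omega
  rw [fubiniAss_eq_sum_fiberBoundedCount hm le_rfl, Finset.sum_range_succ', h0, add_zero]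
  simp_rw [fiberBoundedCount_fin_succ]
  rw [Finset.sum_comm, Finset.sum_range_succ']
  simp only [hm0, if_false, mul_zero, Finset.sum_const_zero, add_zero]
  refine Finset.sum_congr rfl fun j _ => ?_
  rw [← Finset.mul_sum]
  split_ifs with h
  · rw [fubiniAss_eq_sum_fiberBoundedCount hm (Nat.sub_le n j), Nat.add_sub_add_right]
  · simp

theorem fubiniAss_succ_div_factorial {m : ℕ} (hm : 1 ≤ m) (n : ℕ) :
    (fubiniAss m (n + 1) : ℚ) / ((n + 1)! : ℚ) =
      ∑ j ∈ range (n + 1), (if j + 1 < m then 0 else 1 / ((j + 1)! : ℚ)) *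
        ((fubiniAss m (n - j) : ℚ) / ((n - j)! : ℚ)) := by
  rw [fubiniAss_succ hm, Nat.cast_sum, Finset.sum_div]
  refine Finset.sum_congr rfl fun j hj => ?_
  have hj' : j + 1 ≤ n + 1 := by simpa using hj
  by_cases h : m ≤ j + 1
  · rw [if_pos h, if_neg (not_lt.mpr h), Nat.cast_mul, Nat.cast_choose ℚ hj',
      Nat.add_sub_add_right]
    have h1 := Nat.factorial_ne_zero (n + 1)
    have h2 := Nat.factorial_ne_zero (j + 1)
    have h3 := Nat.factorial_ne_zero (n - j)
    field_simp
  · rw [if_neg h, if_pos (not_le.mp h)]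
    simp

/-- If all entries of `H_{n+1}(R) v` but the last vanish, Cramer's rule determines
`det H_{n+1}(R) * v 0`. -/
theorem det_hess_mul_apply_zero (R : ℕ → ℚ) (n : ℕ) (v : Fin (n + 1) → ℚ)
    (hv : ∀ i : Fin n, (hess R (n + 1)).mulVec v i.castSucc = 0) :
    (hess R (n + 1)).det * v 0 =
      (-1) ^ n * (hess R (n + 1)).mulVec v (Fin.last n) := by
  have hc : ((hess R (n + 1)).updateCol 0 ((hess R (n + 1)).mulVec v)).det =
      (hess R (n + 1)).det * v 0 := by
    rw [← Matrix.cramer_apply, Matrix.cramer_eq_adjugate_mulVec, Matrix.mulVec_mulVec,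
      Matrix.adjugate_mul, Matrix.smul_mulVec, Matrix.one_mulVec, Pi.smul_apply, smul_eq_mul]
  have ht : ((hess R (n + 1)).submatrix Fin.castSucc Fin.succ).det = 1 := by
    rw [Matrix.det_of_isLowerTriangular]
    · simp [hess]
    · intro i j hij
      have hij' : (i : ℕ) < j := hij
      simp only [hess, Matrix.submatrix_apply, Matrix.of_apply, Fin.val_castSucc, Fin.val_succ]
      rw [if_neg (by omega), if_neg (by omega)]
  have hs : ((hess R (n + 1)).updateCol 0 ((hess R (n + 1)).mulVec v)).submatrix
      Fin.castSucc Fin.succ = (hess R (n + 1)).submatrix Fin.castSucc Fin.succ := by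
    ext i j
    simp
  rw [← hc, Matrix.det_succ_column_zero, Fin.sum_univ_castSucc]
  simp only [Matrix.updateCol_self, hv, mul_zero, zero_mul, Finset.sum_const_zero, zero_add,
    Fin.succAbove_last, Fin.val_last, hs, ht, mul_one]

theorem hess_mulVec_apply (R : ℕ → ℚ) (n : ℕ) (u : ℕ → ℚ) (i : Fin n) :
    (hess R n).mulVec (fun j => u j) i =
      ∑ j ∈ range (i + 1), R (i - j + 1) * u j + if (i : ℕ) + 1 < n then u (i + 1) else 0 := by
  have hi := i.2
  have h1 : (hess R n).mulVec (fun j => u j) i =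
      ∑ j ∈ range n, ((if j ≤ (i : ℕ) then R (i - j + 1) * u j else 0) +
        if j = (i : ℕ) + 1 then u j else 0) := by
    rw [← Fin.sum_univ_eq_sum_range (fun j : ℕ => (if j ≤ (i : ℕ) then R (i - j + 1) * u j else 0) +
      if j = (i : ℕ) + 1 then u j else 0), Matrix.mulVec, dotProduct]
    refine Finset.sum_congr rfl fun j _ => ?_
    simp only [hess, Matrix.of_apply]
    split_ifs <;> first | omega | simp
  rw [h1, Finset.sum_add_distrib, Finset.sum_ite_eq', ← Finset.sum_filter]
  congr 1
  · refine Finset.sum_congr ?_ fun _ _ => rfl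
    ext j
    simp only [mem_filter, mem_range]
    omega
  · simp

/-- A sequence obeying the Hessenberg-Toeplitz recurrence is the sequence of determinants. -/
theorem det_hess_eq_of_recurrence (R d : ℕ → ℚ) (h0 : d 0 = 1)
    (hd : ∀ n, d (n + 1) = ∑ j ∈ range (n + 1), (-1) ^ j * R (j + 1) * d (n - j)) (n : ℕ) :
    (hess R n).det = d n := by
  obtain _ | n := n
  · simp [h0]
  have key (i : ℕ) :
      ∑ j ∈ range (i + 1), R (i - j + 1) * ((-1) ^ j * d j) = (-1) ^ i * d (i + 1) := by
    rw [hd, ← Finset.sum_range_reflect, Finset.mul_sum]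
    refine Finset.sum_congr rfl fun j hj => ?_
    obtain ⟨l, rfl⟩ := Nat.exists_eq_add_of_le (Nat.lt_succ_iff.mp (mem_range.mp hj))
    have e1 : j + l + 1 - 1 - j = l := by omega
    have e2 : j + l - l = j := by omega
    have e3 : j + l - j = l := by omega
    have e4 : ((-1 : ℚ) ^ j) * (-1) ^ j = 1 := by rw [← mul_pow]; simp
    rw [e1, e2, e3, pow_add]
    linear_combination -(-1) ^ l * R (j + 1) * d l * e4
  have h := det_hess_mul_apply_zero R n (fun j => (-1) ^ (j : ℕ) * d j) fun i => by
    rw [hess_mulVec_apply R (n + 1) (fun j => (-1) ^ j * d j), Fin.val_castSucc, key,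
      if_pos (by omega)]
    ring
  rw [hess_mulVec_apply R (n + 1) (fun j => (-1) ^ j * d j), Fin.val_last, key,
    if_neg (by omega)] at h
  have e : ((-1 : ℚ) ^ n) * (-1) ^ n = 1 := by rw [← mul_pow]; simp
  simp only [Fin.val_zero, pow_zero, h0, mul_one, add_zero] at h
  rw [h, ← mul_assoc, e, one_mul]

theorem fubiniAss_eq_det (m n : ℕ) (hm : 1 ≤ m) (hmn : m ≤ n) :
    (fubiniAss m n : ℚ) =
      (n ! : ℚ) *
        (hess (fun j => if j < m then 0 else (-1 : ℚ) ^ (j - 1) / (j ! : ℚ)) n).det := by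
  rw [det_hess_eq_of_recurrence _ (fun n => (fubiniAss m n : ℚ) / (n ! : ℚ))]
  · have := Nat.factorial_ne_zero n
    field_simp
  · simp [fubiniAss_zero]
  · intro n
    rw [fubiniAss_succ_div_factorial hm]
    refine Finset.sum_congr rfl fun j _ => ?_
    have e : ((-1 : ℚ) ^ j) * (-1) ^ j = 1 := by rw [← mul_pow]; simp
    split_ifs
    · simp
    · rw [Nat.add_sub_cancel, mul_div_assoc' ((-1 : ℚ) ^ j), e]
end

section
/- For all integers n ≥ m ≥ 1, F_{n,≥m}/n! = Σ ((t_m+⋯+t_n)!/(t_m!⋯t_n!)) · (−1)^{n−(t_m+⋯+t_n)} · Π_{j=m}^{n} ((−1)^{j−1}/j!)^{t_j}, where the sum ranges over all tuples (t_m,…,t_n) of nonnegative integers with m·t_m + (m+1)·t_{m+1} + ⋯ + n·t_n = n. -/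
open Nat Finset

theorem card_filter_card_fiber_eq_multinomial {α β : Type*} [Fintype α] [DecidableEq α]
    [Fintype β] [DecidableEq β] (c : β → ℕ) (hc : ∑ b, c b = Fintype.card α) :
    (Finset.univ.filter fun f : α → β =>
      ∀ b, (Finset.univ.filter fun x => f x = b).card = c b).card =
      Nat.multinomial Finset.univ c := by
  have h := MvPolynomial.coeff_sum_X_pow_of_fintype (R := ℕ)
    (Finsupp.equivFunOnFinite.symm c) (Fintype.card α)
  have hpow : (∑ b : β, (MvPolynomial.X b : MvPolynomial β ℕ)) ^ Fintype.card α =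
      ∑ f : α → β, MvPolynomial.monomial
        (Finsupp.equivFunOnFinite.symm
          fun b => (Finset.univ.filter fun x => f x = b).card) 1 := by
    rw [← Finset.card_univ, ← Finset.prod_const, Finset.prod_univ_sum, Fintype.piFinset_univ]
    refine Finset.sum_congr rfl fun f _ => ?_
    rw [MvPolynomial.monomial_eq, Finsupp.prod_fintype _ _ (by simp), ← Finset.prod_fiberwise' _ f]
    simp
  rw [hpow, MvPolynomial.coeff_sum, Finsupp.sum_fintype _ _ (by simp),
    Finsupp.multinomial_eq_of_support_subset (Finset.subset_univ _)] at h
  simp only [MvPolynomial.coeff_monomial, EmbeddingLike.apply_eq_iff_eq, funext_iff] at h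
  simpa [hc] using h

/-- Maps with all fibers of size at least `m`, counted by the excess sizes of their fibers. -/
theorem card_filter_le_card_fiber_div_factorial (m n k : ℕ) (hmn : m ≤ n) :
    ((Finset.univ.filter fun f : Fin n → Fin k =>
      ∀ i, m ≤ (Finset.univ.filter fun x => f x = i).card).card : ℚ) / (n ! : ℚ) =
    ∑ c : Fin k → Fin (n - m + 1) with ∑ i, (m + (c i : ℕ)) = n,
      ∏ i, (1 / ((m + (c i : ℕ))! : ℚ)) := by
  have hlt (f : Fin n → Fin k) (i : Fin k) :
      (Finset.univ.filter fun x => f x = i).card - m < n - m + 1 := by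
    have := Finset.card_le_univ (Finset.univ.filter fun x => f x = i)
    simp only [Fintype.card_fin] at this
    omega
  have hsum (f : Fin n → Fin k) : ∑ i, (Finset.univ.filter fun x => f x = i).card = n := by
    simpa using (Finset.card_eq_sum_card_fiberwise (s := Finset.univ) (t := Finset.univ)
      (f := f) (by simp)).symm
  rw [Finset.card_eq_sum_card_fiberwise
    (f := fun f i => (⟨_, hlt f i⟩ : Fin (n - m + 1)))
    (t := Finset.univ.filter fun c : Fin k → Fin (n - m + 1) => ∑ i, (m + (c i : ℕ)) = n)]
  · rw [Nat.cast_sum, Finset.sum_div]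
    refine Finset.sum_congr rfl fun c hc => ?_
    have hc' : ∑ i, (m + (c i : ℕ)) = n := (Finset.mem_filter.1 hc).2
    have hcount := card_filter_card_fiber_eq_multinomial (α := Fin n)
      (fun i => m + (c i : ℕ)) (by simpa using hc')
    have hspec := Nat.multinomial_spec Finset.univ (fun i => m + (c i : ℕ))
    rw [hc', ← hcount] at hspec
    rw [← hspec, Finset.filter_filter]
    have hset : (Finset.univ.filter fun f : Fin n → Fin k =>
        (∀ i, m ≤ (Finset.univ.filter fun x => f x = i).card) ∧
          (fun i => (⟨_, hlt f i⟩ : Fin (n - m + 1))) = c) =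
        Finset.univ.filter fun f : Fin n → Fin k =>
          ∀ i, (Finset.univ.filter fun x => f x = i).card = m + (c i : ℕ) := by
      ext f
      simp only [Finset.mem_filter, Finset.mem_univ, true_and, funext_iff, Fin.ext_iff,
        ← forall_and]
      refine forall_congr' fun i => ?_
      omega
    rw [hset]
    have hpos := Nat.multinomial_pos Finset.univ (fun i => m + (c i : ℕ))
    rw [← hcount] at hpos
    push_cast
    rw [Finset.prod_div_distrib, Finset.prod_const_one]
    have hne : (∏ i, ((m + (c i : ℕ))! : ℚ)) ≠ 0 :=
      Finset.prod_ne_zero_iff.2 fun i _ => by positivity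
    field_simp
    congr!
  · intro f hf
    simp only [Finset.coe_filter, Finset.mem_univ, true_and, Set.mem_ofPred_eq] at hf ⊢
    refine Eq.trans (Finset.sum_congr rfl fun i _ => ?_) (hsum f)
    have := hf i
    omega

/-- Tuples in `β`, grouped by the number of times each value is taken. -/
theorem sum_filter_prod_eq_sum_multinomial {β : Type*} [Fintype β] [DecidableEq β]
    (w : β → ℕ) (g : β → ℚ) (n k : ℕ) :
    ∑ c : Fin k → β with ∑ i, w (c i) = n, ∏ i, g (c i) =
      ∑ t ∈ Finset.piAntidiag (Finset.univ : Finset β) k with ∑ b, w b * t b = n,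
        (Nat.multinomial Finset.univ t : ℚ) * ∏ b, g b ^ t b := by
  have hsum (c : Fin k → β) : ∑ b, (Finset.univ.filter fun x => c x = b).card = k := by
    simpa using (Finset.card_eq_sum_card_fiberwise (s := Finset.univ) (t := Finset.univ)
      (f := c) (by simp)).symm
  have hw (c : Fin k → β) :
      ∑ i, w (c i) = ∑ b, w b * (Finset.univ.filter fun x => c x = b).card := by
    simp [← Finset.sum_fiberwise' _ c, mul_comm]
  have hg (c : Fin k → β) :
      ∏ i, g (c i) = ∏ b, g b ^ (Finset.univ.filter fun x => c x = b).card := by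
    simp [← Finset.prod_fiberwise' _ c]
  rw [← Finset.sum_fiberwise_of_maps_to
    (g := fun (c : Fin k → β) b => (Finset.univ.filter fun x => c x = b).card)
    (t := (Finset.piAntidiag (Finset.univ : Finset β) k).filter fun t => ∑ b, w b * t b = n)]
  · refine Finset.sum_congr rfl fun t ht => ?_
    simp only [Finset.mem_filter, Finset.mem_piAntidiag] at ht
    rw [← card_filter_card_fiber_eq_multinomial (α := Fin k) t (by simpa using ht.1.1),
      ← nsmul_eq_mul, ← Finset.sum_const, Finset.filter_filter]
    refine Finset.sum_congr ?_ fun c hc => ?_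
    · ext c
      simp only [Finset.mem_filter, Finset.mem_univ, true_and, funext_iff, hw]
      refine ⟨And.right, fun h => ⟨?_, h⟩⟩
      simpa [h] using ht.2
    · simp only [Finset.mem_filter, Finset.mem_univ, true_and] at hc
      simp [hg, hc]
  · intro c hc
    simp only [Finset.mem_filter, Finset.mem_univ, true_and, hw] at hc
    simp [hsum, hc]

theorem fubiniAss_trudi (m n : ℕ) (hm : 1 ≤ m) (hmn : m ≤ n) :
    (fubiniAss m n : ℚ) / (n ! : ℚ) =
      ∑ t ∈ (Fintype.piFinset fun _ : Fin (n - m + 1) => Finset.range (n + 1)).filter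
          (fun t => ∑ j : Fin (n - m + 1), (m + (j : ℕ)) * t j = n),
        (Nat.multinomial Finset.univ t : ℚ) *
          (-1 : ℚ) ^ (n - ∑ j : Fin (n - m + 1), t j) *
          ∏ j : Fin (n - m + 1),
            ((-1 : ℚ) ^ (m + (j : ℕ) - 1) / ((m + (j : ℕ))! : ℚ)) ^ t j := by
  have hle (t : Fin (n - m + 1) → ℕ) (ht : ∑ j : Fin (n - m + 1), (m + (j : ℕ)) * t j = n) :
      ∑ j, t j ≤ n := by
    conv_rhs => rw [← ht]
    exact Finset.sum_le_sum fun j _ => Nat.le_mul_of_pos_left _ (by omega)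
  have hsurj (k : ℕ) : (Finset.univ.filter fun f : Fin n → Fin k => Function.Surjective f ∧
        ∀ i : Fin k, m ≤ (Finset.univ.filter fun x => f x = i).card) =
      Finset.univ.filter fun f : Fin n → Fin k =>
        ∀ i : Fin k, m ≤ (Finset.univ.filter fun x => f x = i).card := by
    refine Finset.filter_congr fun f _ => and_iff_right_of_imp fun h i => ?_
    obtain ⟨x, hx⟩ := Finset.card_pos.1 (hm.trans (h i))
    exact ⟨x, (Finset.mem_filter.1 hx).2⟩
  unfold fubiniAss
  rw [Nat.cast_sum, Finset.sum_div]
  simp only [hsurj, card_filter_le_card_fiber_div_factorial m n _ hmn]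
  rw [← Finset.sum_fiberwise_of_maps_to (g := fun t : Fin (n - m + 1) → ℕ => ∑ j, t j)
    (t := Finset.range (n + 1))]
  · refine Finset.sum_congr rfl fun k _ => ?_
    rw [sum_filter_prod_eq_sum_multinomial (fun j : Fin (n - m + 1) => m + (j : ℕ))
      (fun j => 1 / ((m + (j : ℕ))! : ℚ))]
    refine Finset.sum_congr ?_ fun t ht => ?_
    · ext t
      simp only [Finset.mem_filter, Finset.mem_piAntidiag, Fintype.mem_piFinset,
        Finset.mem_range, Finset.mem_univ, implies_true, and_true]
      refine ⟨fun ⟨h₁, h₂⟩ => ⟨⟨fun j => ?_, h₂⟩, h₁⟩, fun h => ⟨h.2, h.1.2⟩⟩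
      exact Nat.lt_succ_of_le
        ((Finset.single_le_sum (fun i _ => Nat.zero_le (t i)) (Finset.mem_univ j)).trans
          (hle t h₂))
    · have ht' : ∑ j : Fin (n - m + 1), (m + (j : ℕ)) * t j = n :=
        (Finset.mem_filter.1 (Finset.mem_filter.1 ht).1).2
      have hexp : n - ∑ j, t j = ∑ j : Fin (n - m + 1), (m + (j : ℕ) - 1) * t j := by
        rw [Nat.sub_eq_iff_eq_add (hle t ht'), ← Finset.sum_add_distrib]
        conv_lhs => rw [← ht']
        refine Finset.sum_congr rfl fun j _ => ?_
        rw [← Nat.succ_mul]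
        congr 1
        omega
      rw [hexp, ← Finset.prod_pow_eq_pow_sum, mul_assoc, ← Finset.prod_mul_distrib]
      congr 1
      refine Finset.prod_congr rfl fun j _ => ?_
      rw [pow_mul, ← mul_pow, mul_div_assoc', ← mul_pow]
      norm_num
  · intro t ht
    exact Finset.mem_range.2 (Nat.lt_succ_of_le (hle t (Finset.mem_filter.1 ht).2))
end
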